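/- arXiv:1501.03753 — 5 statements merged into one kernel-verified Lean document; each statement's English description precedes it below -/
import Mathlib

section
/- Let k be an algebraically closed field and let R be a finitely generated commutative k-algebra. (i) For any two distinct k-algebra homomorphisms φ₁ ≠ φ₂ : R → k, the set { f ∈ R : φ₁(f) = φ₂(f) } is a maximal k-subalgebra of R. (ii) For any k-algebra homomorphism φ : R → k and any nonzero k-linear map δ : R → k satisfying δ(fg) = φ(f)δ(g) + φ(g)δ(f) for all f, g ∈ R, the set { f ∈ R : δ(f) = 0 } is a maximal k-subalgebra of R. (iii) Conversely, every maximal k-subalgebra A of R for which the induced map Spec R → Spec A is surjective is of the form (i) or of the form (ii). -/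
/-- `A` is a maximal `k`-subalgebra of `R`: `A ≠ R` and there is no `k`-subalgebra
strictly between `A` and `R`. -/
def IsMaximalSubalgebra (k : Type*) {R : Type*} [CommSemiring k] [CommRing R]
    [Algebra k R] (A : Subalgebra k R) : Prop :=
  A ≠ ⊤ ∧ ∀ B : Subalgebra k R, A < B → B = ⊤

theorem IsMaximalSubalgebra.of_coe_eq_ker {k R : Type*} [Field k] [CommRing R] [Algebra k R]
    {A : Subalgebra k R} {ψ : R →ₗ[k] k} (hψ : ψ ≠ 0) (hA : (A : Set R) = {f | ψ f = 0}) :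
    IsMaximalSubalgebra k A := by
  have mem (f : R) : f ∈ A ↔ ψ f = 0 := Set.ext_iff.mp hA f
  refine ⟨?_, fun B hB => ?_⟩
  · rintro rfl
    exact hψ (LinearMap.ext fun f => (mem f).mp trivial)
  · obtain ⟨hle, b, hbB, hbA⟩ := SetLike.lt_iff_le_and_exists.mp hB
    rw [mem] at hbA
    refine eq_top_iff.mpr fun f _ => ?_
    have h : f - (ψ f / ψ b) • b ∈ A := by
      rw [mem]
      simp [hbA]
    simpa using B.add_mem (hle h) (B.smul_mem hbB (ψ f / ψ b))

theorem IsMaximalSubalgebra.eq_of_le {k R : Type*} [CommSemiring k] [CommRing R] [Algebra k R]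
    {A B : Subalgebra k R} (hA : IsMaximalSubalgebra k A) (hB : B ≠ ⊤) (h : A ≤ B) : A = B :=
  h.eq_or_lt.resolve_right fun hlt => hB (hA.2 B hlt)

/-- The kernel of a point derivation, as a subalgebra. -/
def kerPointDerivation {k R : Type*} [Field k] [CommRing R] [Algebra k R] {φ : R →ₐ[k] k}
    {δ : R →ₗ[k] k} (hmul : ∀ f g : R, δ (f * g) = φ f * δ g + φ g * δ f) : Subalgebra k R :=
  δ.ker.toSubalgebra
    (by
      have h := hmul 1 1
      simpa using h)
    (fun f g hf hg => by
      rw [LinearMap.mem_ker] at hf hg ⊢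
      simp [hmul, hf, hg])

/-- The dichotomy coming from the intermediate subalgebra `A + J`. -/
theorem IsMaximalSubalgebra.ideal_subset_or {k R : Type*} [CommRing k] [CommRing R] [Algebra k R]
    {A : Subalgebra k R} (hA : IsMaximalSubalgebra k A) (J : Ideal R) :
    (∀ x ∈ J, x ∈ A) ∨ ∀ x, ∃ a ∈ A, x - a ∈ J := by
  set B := (A.map (Ideal.Quotient.mkₐ k J)).comap (Ideal.Quotient.mkₐ k J) with hB
  have mem (x : R) : x ∈ B ↔ ∃ a ∈ A, x - a ∈ J := by
    simp only [hB, Subalgebra.mem_comap, Subalgebra.mem_map, Ideal.Quotient.mkₐ_eq_mk]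
    refine exists_congr fun a => and_congr_right fun _ => ?_
    rw [eq_comm, Ideal.Quotient.eq]
  have hle : A ≤ B := fun a ha => (mem a).mpr ⟨a, ha, by simp⟩
  by_cases htop : B = ⊤
  · exact Or.inr fun x => (mem x).mp (htop ▸ trivial)
  · refine Or.inl fun x hx => ?_
    rw [hA.eq_of_le htop hle, mem]
    exact ⟨0, A.zero_mem, by simpa⟩

theorem Ideal.IsMaximal.exists_algHom_ker_eq {k R : Type*} [Field k] [IsAlgClosed k] [CommRing R]
    [Algebra k R] [Algebra.FiniteType k R] (q : Ideal R) [q.IsMaximal] :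
    ∃ φ : R →ₐ[k] k, ∀ x, φ x = 0 ↔ x ∈ q := by
  let := Ideal.Quotient.field q
  have : Algebra.FiniteType k (R ⧸ q) :=
    .of_surjective (Ideal.Quotient.mkₐ k q) (Ideal.Quotient.mkₐ_surjective k q)
  have : Module.Finite k (R ⧸ q) := finite_of_finite_type_of_isJacobsonRing k (R ⧸ q)
  let e : k ≃ₐ[k] (R ⧸ q) := AlgEquiv.ofBijective (Algebra.ofId k (R ⧸ q))
    IsAlgClosed.algebraMap_bijective_of_isIntegral
  refine ⟨(e.symm : (R ⧸ q) →ₐ[k] k).comp (Ideal.Quotient.mkₐ k q), fun x => ?_⟩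
  simp [Ideal.Quotient.eq_zero_iff_mem]

open Polynomial in
/-- If `A` is integrally closed in `R` and a prime `q` of `R` contains the denominators of `x`,
then it contains the coefficients of every polynomial over `A` vanishing at `x`. -/
theorem coeff_mem_of_aeval_eq_zero {k R : Type*} [CommRing k] [CommRing R] [Algebra k R]
    {A : Subalgebra k R} (hint : ∀ y : R, IsIntegral A y → y ∈ A) {x : R} {q : Ideal R}
    (hq : ∀ a ∈ A, a * x ∈ A → a ∈ q) (n : ℕ) :
    ∀ p : A[X], p.natDegree ≤ n → aeval x p = 0 → ∀ i, (p.coeff i : R) ∈ q := by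
  induction n with
  | zero =>
    intro p hp h i
    rw [eq_C_of_natDegree_le_zero hp, aeval_C] at h
    have h0 : p.coeff 0 = 0 := Subtype.ext h
    rw [eq_C_of_natDegree_le_zero hp, h0]
    simp
  | succ n ih =>
    intro p hp h i
    have hlead : (p.coeff (n + 1) : R) * x ∈ A := by
      by_cases hn : p.natDegree = n + 1
      · have := isIntegral_leadingCoeff_smul p x h
        rw [leadingCoeff, hn] at this
        exact hint _ this
      · rw [coeff_eq_zero_of_natDegree_lt (by omega)]
        simp
    have hmem := hq _ (p.coeff (n + 1)).2 hlead
    set c : A := p.coeff (n + 1) with hc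
    have key := ih (p - C c * X ^ (n + 1) + C ⟨_, hlead⟩ * X ^ n) ?_ ?_
    · have hi := key i
      simp only [coeff_add, coeff_sub, coeff_C_mul, coeff_X_pow] at hi
      have h1 : (c : R) * x ∈ q := q.mul_mem_right _ hmem
      by_cases h2 : i = n + 1
      · rw [h2]
        exact hmem
      · by_cases h3 : i = n
        · subst h3
          simp only [h2, if_false, if_true, mul_zero, mul_one, sub_zero] at hi
          have := q.sub_mem hi h1
          simpa using this
        · simpa [h2, h3] using hi
    · rw [natDegree_le_iff_coeff_eq_zero]
      intro j hj
      simp only [coeff_add, coeff_sub, coeff_C_mul, coeff_X_pow]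
      by_cases h2 : j = n + 1
      · subst h2
        simp [hc]
      · have : p.coeff j = 0 := coeff_eq_zero_of_natDegree_lt (by omega)
        simp [this, h2, show j ≠ n by omega]
    · simp only [map_add, map_sub, h, map_mul, aeval_C, aeval_X_pow, Subalgebra.algebraMap_def,
        Algebra.algebraMap_self_apply]
      ring

open Polynomial in
theorem IsMaximalSubalgebra.isIntegral {k R : Type*} [CommRing k] [CommRing R] [Algebra k R]
    {A : Subalgebra k R} (hA : IsMaximalSubalgebra k A)
    (hs : Function.Surjective (PrimeSpectrum.comap (A.val : ↥A →ₐ[k] R).toRingHom)) :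
    Algebra.IsIntegral A R := by
  refine ⟨?_⟩
  by_contra! hne
  have hclosed : ∀ y : R, IsIntegral A y → y ∈ A := by
    set B := (integralClosure A R).restrictScalars k with hB
    have hBtop : B ≠ ⊤ := by
      obtain ⟨y, hy⟩ := hne
      intro h
      exact hy (show y ∈ B from h ▸ trivial)
    have hle : A ≤ B := fun a ha =>
      show IsIntegral A a from isIntegral_algebraMap (x := (⟨a, ha⟩ : A))
    intro y hy
    rw [hA.eq_of_le hBtop hle]
    exact hy
  obtain ⟨x, hx⟩ : ∃ x, x ∉ A := by
    obtain ⟨y, hy⟩ := hne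
    exact ⟨y, fun h => hy (isIntegral_algebraMap (x := (⟨y, h⟩ : A)))⟩
  have hx2 : x ^ 2 ∉ A := fun h => hx <| hclosed x <|
    IsIntegral.of_pow two_pos (isIntegral_algebraMap (x := (⟨x ^ 2, h⟩ : A)))
  obtain ⟨g, hg⟩ : ∃ g : A[X], aeval (x ^ 2) g = x := by
    have : (Algebra.adjoin A {x ^ 2}).restrictScalars k = ⊤ := by
      refine hA.2 _ (SetLike.lt_iff_le_and_exists.mpr ⟨fun a ha => ?_, x ^ 2, ?_, hx2⟩)
      · exact (Algebra.adjoin A {x ^ 2}).algebraMap_mem ⟨a, ha⟩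
      · exact Algebra.self_mem_adjoin_singleton A (x ^ 2)
    have hmem : x ∈ Algebra.adjoin A {x ^ 2} :=
      show x ∈ (Algebra.adjoin A {x ^ 2}).restrictScalars k from this ▸ trivial
    rwa [Algebra.adjoin_singleton_eq_range_aeval] at hmem
  let D : Ideal A :=
    { carrier := {a | (a : R) * x ∈ A}
      add_mem' := fun {a b} ha hb => by
        simpa [add_mul] using A.add_mem ha hb
      zero_mem' := by simp
      smul_mem' := fun c a ha => by
        simpa [mul_assoc] using A.mul_mem c.2 ha }
  have hD : D ≠ ⊤ := fun h => hx <| by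
    simpa [D] using (Ideal.eq_top_iff_one D).mp h
  obtain ⟨m, hm, hDm⟩ := Ideal.exists_le_maximal D hD
  obtain ⟨q, hq⟩ := hs ⟨m, hm.isPrime⟩
  have hqm (a : A) (ha : a ∈ m) : (a : R) ∈ q.asIdeal := by
    have : m = q.asIdeal.comap (A.val : ↥A →ₐ[k] R).toRingHom :=
      (congrArg PrimeSpectrum.asIdeal hq).symm
    rw [this] at ha
    exact ha
  have hcoeff := coeff_mem_of_aeval_eq_zero hclosed (x := x) (q := q.asIdeal)
    (fun a ha hax => hqm ⟨a, ha⟩ (hDm hax)) _ (expand A 2 g - X) le_rfl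
    (by simp [expand_aeval, hg]) 1
  refine q.isPrime.ne_top ((Ideal.eq_top_iff_one _).mpr ?_)
  have h1 : (expand A 2 g).coeff 1 = 0 := by
    rw [coeff_expand two_pos]
    simp
  simpa [h1] using hcoeff

/-- The conductor of a finite maximal subalgebra is maximal in the subalgebra. -/
theorem IsMaximalSubalgebra.exists_ideal {k R : Type*} [CommRing k] [CommRing R] [Algebra k R]
    {A : Subalgebra k R} (hA : IsMaximalSubalgebra k A) [Module.Finite A R] :
    ∃ J : Ideal R, (∀ x ∈ J, x ∈ A) ∧ (J.comap (algebraMap A R)).IsMaximal := by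
  have hbot : LinearMap.range (Algebra.linearMap A R) ≠ ⊤ := by
    intro h
    refine hA.1 (eq_top_iff.mpr fun x _ => ?_)
    obtain ⟨a, ha⟩ : x ∈ LinearMap.range (Algebra.linearMap A R) := h ▸ trivial
    exact ha ▸ a.2
  obtain ⟨N, hN, hAN⟩ := (eq_top_or_exists_le_coatom _).resolve_left hbot
  have hsimple : IsSimpleModule A (R ⧸ N) := isSimpleModule_iff_isCoatom.mpr hN
  let J : Ideal R :=
    { carrier := {r | ∀ s, r * s ∈ N}
      add_mem' := fun {a b} ha hb s => by
        simpa [add_mul] using N.add_mem (ha s) (hb s)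
      zero_mem' := by simp
      smul_mem' := fun c a ha s => by
        simpa [mul_assoc, mul_left_comm] using ha (c * s) }
  refine ⟨J, (hA.ideal_subset_or J).resolve_right fun h => ?_, ?_⟩
  · refine hN.1 (eq_top_iff.mpr fun x _ => ?_)
    obtain ⟨a, ha, hxa⟩ := h x
    have h1 : x - a ∈ N := by simpa using hxa 1
    have h2 : a ∈ N := hAN ⟨⟨a, ha⟩, rfl⟩
    simpa using N.add_mem h1 h2
  · have hann : J.comap (algebraMap A R) = Module.annihilator A (R ⧸ N) := by
      ext a
      rw [Module.mem_annihilator, (Submodule.mkQ_surjective N).forall]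
      refine forall_congr' fun s => ?_
      rw [← map_smul, Submodule.mkQ_apply, Submodule.Quotient.mk_eq_zero, Algebra.smul_def]
    rw [hann]
    exact IsSimpleModule.annihilator_isMaximal

theorem IsMaximalSubalgebra.eq_equalizer_or_eq_ker_derivation
    {k R : Type*} [Field k] [IsAlgClosed k] [CommRing R] [Algebra k R] [Algebra.FiniteType k R]
    {A : Subalgebra k R} (hA : IsMaximalSubalgebra k A)
    (hs : Function.Surjective (PrimeSpectrum.comap (A.val : ↥A →ₐ[k] R).toRingHom)) :
    (∃ φ₁ φ₂ : R →ₐ[k] k, φ₁ ≠ φ₂ ∧ (A : Set R) = {f : R | φ₁ f = φ₂ f}) ∨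
      (∃ (φ : R →ₐ[k] k) (δ : R →ₗ[k] k), δ ≠ 0 ∧
        (∀ f g : R, δ (f * g) = φ f * δ g + φ g * δ f) ∧
        (A : Set R) = {f : R | δ f = 0}) := by
  have := hA.isIntegral hs
  have : Algebra.FiniteType A R := .of_restrictScalars_finiteType k A R
  have : Module.Finite A R := Algebra.IsIntegral.finite
  obtain ⟨J, hJA, hJmax⟩ := hA.exists_ideal
  have hJtop : J ≠ ⊤ := by
    rintro rfl
    exact hJmax.ne_top Ideal.comap_top
  obtain ⟨q, hq, hJq⟩ := J.exists_le_maximal hJtop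
  obtain ⟨φ, hφ⟩ := Ideal.IsMaximal.exists_algHom_ker_eq (k := k) q
  have hJeq : J.comap (algebraMap A R) = q.comap (algebraMap A R) :=
    hJmax.eq_of_le (Ideal.comap_ne_top _ hq.ne_top) (Ideal.comap_mono hJq)
  have hAJ (a : R) (ha : a ∈ A) (h0 : φ a = 0) : a ∈ J := by
    have : (⟨a, ha⟩ : A) ∈ J.comap (algebraMap A R) := by
      rw [hJeq]
      exact (hφ a).mp h0
    exact this
  have hA' (a : R) (ha : a ∈ A) : a - algebraMap k R (φ a) ∈ J :=
    hAJ _ (A.sub_mem ha (A.algebraMap_mem _)) (by simp)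
  have hφJ (a : R) (ha : a ∈ J) : φ a = 0 := (hφ a).mpr (hJq ha)
  -- there is no ideal strictly between `J` and the kernel of `φ`
  have hmin (I : Ideal R) (hJI : J ≤ I) (hI : ∀ x ∈ I, φ x = 0) :
      (∀ x ∈ I, x ∈ J) ∨ ∀ x, φ x = 0 → x ∈ I := by
    refine (hA.ideal_subset_or I).imp (fun h x hx => hAJ x (h x hx) (hI x hx)) fun h x hx => ?_
    obtain ⟨a, ha, hxa⟩ := h x
    have h0 := hI _ hxa
    rw [map_sub, hx, zero_sub, neg_eq_zero] at h0
    simpa using I.add_mem hxa (hJI (hAJ a ha h0))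
  obtain ⟨y, hyA, hy0⟩ : ∃ y, y ∉ A ∧ φ y = 0 := by
    obtain ⟨x, -, hx⟩ := SetLike.exists_of_lt (lt_top_iff_ne_top.mpr hA.1)
    refine ⟨x - algebraMap k R (φ x), fun h => hx ?_, by simp⟩
    simpa using A.add_mem h (A.algebraMap_mem (φ x))
  have hyJ : y ∉ J := fun h => hyA (hJA y h)
  -- `R` acts on `ker φ / J` through a character `χ`
  obtain ⟨χ, hχ⟩ : ∃ χ : R →ₐ[k] k, ∀ r, χ r = 0 → r * y ∈ J := by
    have hKtop : J.colon {y} ≠ ⊤ := fun h => hyJ <| by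
      have h1 : (1 : R) ∈ J.colon {y} := h ▸ trivial
      simpa [Submodule.mem_colon_singleton] using h1
    obtain ⟨p, hp, hKp⟩ := Ideal.exists_le_maximal _ hKtop
    obtain ⟨χ, hχ⟩ := Ideal.IsMaximal.exists_algHom_ker_eq (k := k) p
    refine ⟨χ, fun r hr => ?_⟩
    have hI : ∀ x ∈ J ⊔ p * Ideal.span {y}, φ x = 0 := by
      intro x hx
      obtain ⟨j, hj, z, hz, rfl⟩ := Submodule.mem_sup.mp hx
      obtain ⟨t, -, rfl⟩ := Ideal.mem_mul_span_singleton.mp hz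
      simp [hφJ j hj, hy0]
    rcases hmin _ le_sup_left hI with h | h
    · exact h _ (Ideal.mem_sup_right
        (Ideal.mem_mul_span_singleton.mpr ⟨r, (hχ r).mp hr, rfl⟩))
    · exfalso
      obtain ⟨j, hj, z, hz, hjz⟩ := Submodule.mem_sup.mp (h y hy0)
      obtain ⟨t, ht, rfl⟩ := Ideal.mem_mul_span_singleton.mp hz
      have h1 : 1 - t ∈ p := hKp <| by
        rw [Submodule.mem_colon_singleton, smul_eq_mul]
        convert hj using 1
        linear_combination -hjz
      exact hp.ne_top ((Ideal.eq_top_iff_one p).mpr (by simpa using p.add_mem h1 ht))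
  have hχy (r : R) : r * y - algebraMap k R (χ r) * y ∈ J := by
    rw [← sub_mul]
    exact hχ _ (by simp)
  have hscalar (c : k) (hc : algebraMap k R c * y ∈ J) : c = 0 := by
    by_contra h
    have h1 := J.mul_mem_left (algebraMap k R c⁻¹) hc
    rw [← mul_assoc, ← map_mul, inv_mul_cancel₀ h, map_one, one_mul] at h1
    exact hyJ h1
  have hχJ (j : R) (hj : j ∈ J) : χ j = 0 :=
    hscalar _ (by simpa using J.sub_mem (J.mul_mem_right y hj) (hχy j))
  by_cases hne : φ = χ
  · subst hne
    right
    have hex (r : R) : ∃ d : k, r - algebraMap k R (φ r) - algebraMap k R d * y ∈ J := by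
      have hI : ∀ x ∈ J ⊔ Ideal.span {y}, φ x = 0 := by
        intro x hx
        obtain ⟨j, hj, z, hz, rfl⟩ := Submodule.mem_sup.mp hx
        obtain ⟨t, rfl⟩ := Ideal.mem_span_singleton'.mp hz
        simp [hφJ j hj, hy0]
      rcases hmin _ le_sup_left hI with h | h
      · exact absurd (h y (Ideal.mem_sup_right (Ideal.mem_span_singleton_self y))) hyJ
      · obtain ⟨j, hj, z, hz, hjz⟩ :=
          Submodule.mem_sup.mp (h (r - algebraMap k R (φ r)) (by simp))
        obtain ⟨t, rfl⟩ := Ideal.mem_span_singleton'.mp hz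
        refine ⟨φ t, ?_⟩
        convert J.add_mem hj (hχy t) using 1
        linear_combination -hjz
    choose d hd using hex
    have huniq (r : R) (c : k) (h : r - algebraMap k R (φ r) - algebraMap k R c * y ∈ J) :
        d r = c := by
      refine sub_eq_zero.mp (hscalar _ ?_)
      convert J.sub_mem h (hd r) using 1
      rw [map_sub]
      ring
    let δ : R →ₗ[k] k :=
      { toFun := d
        map_add' := fun f g => huniq _ _ <| by
          convert J.add_mem (hd f) (hd g) using 1
          simp only [map_add]
          ring
        map_smul' := fun c f => huniq _ _ <| by
          convert J.mul_mem_left (algebraMap k R c) (hd f) using 1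
          simp only [Algebra.smul_def, map_mul, AlgHom.commutes, RingHom.id_apply,
            Algebra.algebraMap_self_apply]
          ring }
    have hmul (f g : R) : δ (f * g) = φ f * δ g + φ g * δ f := by
      refine huniq _ _ ?_
      change f * g - algebraMap k R (φ (f * g)) -
        algebraMap k R (φ f * d g + φ g * d f) * y ∈ J
      have h1 := J.mul_mem_left g (hd f)
      have h2 := J.mul_mem_left (algebraMap k R (φ f)) (hd g)
      have h3 := J.mul_mem_left (algebraMap k R (d f)) (hχy g)
      convert J.add_mem (J.add_mem h1 h2) h3 using 1
      simp only [map_add, map_mul]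
      ring
    have hδ : δ ≠ 0 := fun h => by
      have h1 : d y = 1 := huniq y 1 (by simp [hy0])
      exact zero_ne_one ((LinearMap.congr_fun h y).symm.trans h1)
    refine ⟨φ, δ, hδ, hmul, ?_⟩
    have hK : IsMaximalSubalgebra k (kerPointDerivation hmul) := .of_coe_eq_ker hδ rfl
    have hle : A ≤ kerPointDerivation hmul := fun a ha =>
      huniq a 0 (by simpa using hA' a ha)
    exact congrArg _ (hA.eq_of_le hK.1 hle)
  · left
    refine ⟨φ, χ, hne, ?_⟩
    have htop : AlgHom.equalizer φ χ ≠ ⊤ := fun h => hne <| AlgHom.ext fun r =>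
      (AlgHom.mem_equalizer φ χ r).mp (h ▸ trivial)
    have hle : A ≤ AlgHom.equalizer φ χ := fun a ha => by
      have h := hχJ _ (hA' a ha)
      rw [map_sub, AlgHom.commutes, sub_eq_zero] at h
      exact h.symm
    exact congrArg _ (hA.eq_of_le htop hle)

theorem classification_nonextending_maximal_subalgebras
    {k R : Type*} [Field k] [IsAlgClosed k] [CommRing R] [Algebra k R]
    [Algebra.FiniteType k R] :
    -- (i)
    (∀ φ₁ φ₂ : R →ₐ[k] k, φ₁ ≠ φ₂ →
      ∃ A : Subalgebra k R, (A : Set R) = {f : R | φ₁ f = φ₂ f} ∧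
        IsMaximalSubalgebra k A) ∧
    -- (ii)
    (∀ (φ : R →ₐ[k] k) (δ : R →ₗ[k] k), δ ≠ 0 →
      (∀ f g : R, δ (f * g) = φ f * δ g + φ g * δ f) →
      ∃ A : Subalgebra k R, (A : Set R) = {f : R | δ f = 0} ∧
        IsMaximalSubalgebra k A) ∧
    -- (iii)
    (∀ A : Subalgebra k R, IsMaximalSubalgebra k A →
      Function.Surjective (PrimeSpectrum.comap (A.val : ↥A →ₐ[k] R).toRingHom) →
      ((∃ φ₁ φ₂ : R →ₐ[k] k, φ₁ ≠ φ₂ ∧ (A : Set R) = {f : R | φ₁ f = φ₂ f}) ∨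
       (∃ (φ : R →ₐ[k] k) (δ : R →ₗ[k] k), δ ≠ 0 ∧
         (∀ f g : R, δ (f * g) = φ f * δ g + φ g * δ f) ∧
         (A : Set R) = {f : R | δ f = 0}))) := by
  refine ⟨fun φ₁ φ₂ hne => ?_, fun φ δ hδ hmul => ?_, fun A hA hs =>
    hA.eq_equalizer_or_eq_ker_derivation hs⟩
  · refine ⟨AlgHom.equalizer φ₁ φ₂, rfl, .of_coe_eq_ker (ψ := φ₁.toLinearMap - φ₂.toLinearMap)
      (fun h => hne (AlgHom.ext fun f => ?_)) ?_⟩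
    · simpa [sub_eq_zero] using LinearMap.congr_fun h f
    · ext f
      simp [sub_eq_zero]
  · exact ⟨kerPointDerivation hmul, rfl, .of_coe_eq_ker hδ rfl⟩
end

section
/- Let k be an algebraically closed field and let R be an integral domain which is a finitely generated k-algebra of Krull dimension 1. Then every k-subalgebra A of R is either equal to the image of k in R, or A is an integral domain which is a finitely generated k-algebra of Krull dimension 1. -/
open IsDedekindDomain Polynomial

theorem isNoetherian_of_finite_ringHom_of_injective {R T M N : Type*} [CommRing R] [CommRing T]
    [AddCommGroup M] [AddCommGroup N] [Module R M] [Module T N] [IsNoetherianRing R]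
    [Module.Finite T N] {φ : R →+* T} (hφ : φ.Finite) (g : M →ₛₗ[φ] N)
    (hg : Function.Injective g) : IsNoetherian R M := by
  algebraize [φ]
  let _ : Module R N := Module.compHom N φ
  have : IsScalarTower R T N := .of_compHom R T N
  have : Module.Finite R N := .trans T N
  exact isNoetherian_of_injective
    ({ g with map_smul' := fun r m ↦ g.map_smulₛₗ r m } : M →ₗ[R] N)
    hg

theorem iterateFrobenius_finite_of_finiteType (k T : Type*) [Field k] [CommRing T] [Algebra k T]
    [Algebra.FiniteType k T] (p : ℕ) [ExpChar k p] [ExpChar T p] [PerfectRing k p] (n : ℕ) :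
    (iterateFrobenius T p n).Finite := by
  refine RingHom.IsIntegral.to_finite (fun x ↦ ?_) ?_
  · have hq : p ^ n ≠ 0 := (expChar_pow_pos k p n).ne'
    exact ⟨Polynomial.X ^ p ^ n - Polynomial.C x, Polynomial.monic_X_pow_sub_C x hq, by
      simp [iterateFrobenius_def]⟩
  · refine RingHom.FiniteType.of_comp_finiteType (f := algebraMap k T) ?_
    have h : (iterateFrobenius T p n).comp (algebraMap k T) =
        (algebraMap k T).comp (iterateFrobenius k p n) := by
      ext x
      simp [iterateFrobenius_def]
    rw [h]
    exact (RingHom.finiteType_algebraMap.mpr ‹_›).comp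
      (.of_surjective _ (bijective_iterateFrobenius k p n).2)

theorem isNoetherian_integralClosure_of_iterateFrobenius_finite (C F K : Type*) [CommRing C]
    [IsDomain C] [IsIntegrallyClosed C] [IsNoetherianRing C] [Field F] [Field K] [Algebra C F]
    [IsFractionRing C F] [Algebra F K] [Algebra C K] [IsScalarTower C F K]
    [FiniteDimensional F K] (p : ℕ) [ExpChar C p]
    (hC : ∀ n, (iterateFrobenius C p n).Finite) : IsNoetherian C (integralClosure C K) := by
  have : ExpChar F p := expChar_of_injective_algebraMap (IsFractionRing.injective C F) p
  let S := separableClosure F K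
  have : IsScalarTower C S K := .to₁₃₄ C F S K
  have : ExpChar S p := expChar_of_injective_algebraMap (algebraMap F S).injective p
  have : ExpChar K p := expChar_of_injective_algebraMap (algebraMap F K).injective p
  have : IsNoetherian C (integralClosure C S) := IsIntegralClosure.isNoetherian C F S _
  let n := IsPurelyInseparable.exponent S K
  let ψ : K →+* S := IsPurelyInseparable.iterateFrobenius S K p (le_refl n)
  have hψ (x : K) : algebraMap S K (ψ x) = x ^ p ^ n :=
    IsPurelyInseparable.algebraMap_iterateFrobenius S p (le_refl n) x
  have hψi (x : integralClosure C K) : ψ x ∈ integralClosure C S := by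
    refine (isIntegral_algebraMap_iff (algebraMap S K).injective).mp ?_
    rw [hψ]
    exact x.2.pow _
  let g : integralClosure C K →ₛₗ[iterateFrobenius C p n] integralClosure C S :=
    { toFun := fun x ↦ ⟨ψ x, hψi x⟩
      map_add' := fun x y ↦ Subtype.ext (by simp)
      map_smul' := fun r x ↦ by
        refine Subtype.ext ((algebraMap S K).injective ?_)
        change algebraMap S K (ψ (r • x : integralClosure C K)) =
          algebraMap S K (iterateFrobenius C p n r • ψ x)
        rw [hψ, Subalgebra.coe_smul, Algebra.smul_def r, Algebra.smul_def _ (ψ x), map_mul,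
          ← IsScalarTower.algebraMap_apply, hψ, mul_pow, iterateFrobenius_def, map_pow] }
  exact isNoetherian_of_finite_ringHom_of_injective (hC n) g
    fun x y h ↦ Subtype.ext (ψ.injective (congrArg Subtype.val h))

theorem IsDedekindDomain.exists_finset_subset_adjoin {D K : Type*} [CommRing D]
    [IsDedekindDomain D] [Field K] [Algebra D K] [IsFractionRing D K] (A : Set K) {f : D}
    (hf : f ≠ 0) (hA : ∀ a ∈ A, ∃ n : ℕ, f ^ n • a ∈ (algebraMap D K).range) :
    ∃ S : Finset K, ↑S ⊆ A ∧ A ⊆ Algebra.adjoin D (S : Set K) := by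
  classical
  have hT : {v : HeightOneSpectrum D | f ∈ v.asIdeal}.Finite := by
    simpa [Ideal.dvd_span_singleton] using
      Ideal.finite_factors (I := Ideal.span {f}) (by simpa using hf)
  let pole (v : HeightOneSpectrum D) : Prop := ∃ a ∈ A, 1 < v.valuation K a
  let b (v : HeightOneSpectrum D) : K := if h : pole v then h.choose else 0
  have hb {v} (h : pole v) : b v ∈ A ∧ 1 < v.valuation K (b v) := by
    simpa only [b, dif_pos h] using h.choose_spec
  refine ⟨(hT.toFinset.filter pole).image b, ?_, fun a ha ↦ ?_⟩
  · intro x hx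
    simp only [Finset.coe_image, Set.mem_image, Finset.mem_coe, Finset.mem_filter] at hx
    obtain ⟨v, ⟨-, hv⟩, rfl⟩ := hx
    exact (hb hv).1
  set E := Algebra.adjoin D (((hT.toFinset.filter pole).image b : Finset K) : Set K) with hE
  let J : Ideal E := (1 : Submodule E K).comap (LinearMap.toSpanSingleton E K a)
  have hJ (e : E) : e ∈ J ↔ (e : K) * a ∈ E := by
    simp [J, Submodule.mem_one, Algebra.smul_def]
  suffices J = ⊤ by simpa [hJ] using (Ideal.eq_top_iff_one J).mp this
  by_contra hne
  obtain ⟨M, hM, hJM⟩ := Ideal.exists_le_maximal J hne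
  obtain ⟨n, d, hd⟩ := hA a ha
  have hfJ : algebraMap D E (f ^ n) ∈ J := by
    rw [hJ]
    have : ((algebraMap D E (f ^ n) : E) : K) * a = algebraMap D K d := by
      rw [hd, Algebra.smul_def]; rfl
    rw [this]
    exact E.algebraMap_mem d
  let v : HeightOneSpectrum D :=
    ⟨M.comap (algebraMap D E), inferInstance, fun h ↦ pow_ne_zero n hf <| by
      have : f ^ n ∈ M.comap (algebraMap D E) := hJM hfJ
      simpa [h] using this⟩
  have mem_loc (x : K) (hx : v.valuation K x ≤ 1) :
      ∃ c s : D, s ∉ v.asIdeal ∧ algebraMap D K s * x = algebraMap D K c := by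
    rw [← Valuation.mem_valuationSubring_iff,
      ← HeightOneSpectrum.valuationSubringAtPrime_eq_valuationSubring] at hx
    obtain ⟨c, s, hs, rfl⟩ := hx
    have hs0 : algebraMap D K s ≠ 0 := by
      rw [map_ne_zero_iff _ (IsFractionRing.injective D K)]
      rintro rfl
      exact hs v.asIdeal.zero_mem
    exact ⟨c, s, hs, by field_simp⟩
  have hEv (e : K) (he : e ∈ E) : v.valuation K e ≤ 1 := by
    by_contra! h
    have hlt : v.valuation K e⁻¹ < 1 := by
      rw [map_inv₀]; exact inv_lt_one_of_one_lt₀ h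
    obtain ⟨c, s, hs, hcs⟩ := mem_loc e⁻¹ hlt.le
    have he0 : e ≠ 0 := by rintro rfl; simp at h
    have hc : c ∈ v.asIdeal := by
      rw [← v.valuation_lt_one_iff_mem (K := K)]
      change v.valuation K (algebraMap D K c) < 1
      rw [← hcs, map_mul]
      exact (mul_le_of_le_one_left' (v.valuation_le_one s)).trans_lt hlt
    apply hs
    have : algebraMap D E s = algebraMap D E c * ⟨e, he⟩ := by
      apply Subtype.ext
      change algebraMap D K s = algebraMap D K c * e
      rw [← hcs, mul_assoc, inv_mul_cancel₀ he0, mul_one]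
    change algebraMap D E s ∈ M
    rw [this]
    exact M.mul_mem_right _ hc
  have hav : v.valuation K a ≤ 1 := by
    by_contra! h
    have hp : pole v := ⟨a, ha, h⟩
    refine (hb hp).2.not_ge (hEv _ (Algebra.subset_adjoin ?_))
    have hfv : f ∈ v.asIdeal := v.isPrime.mem_of_pow_mem n (hJM hfJ)
    simp only [Finset.coe_image]
    exact ⟨v, by simp [hfv, hp], rfl⟩
  obtain ⟨c, s, hs, hcs⟩ := mem_loc a hav
  apply hs
  refine hJM ((hJ _).mpr ?_)
  change algebraMap D K s * a ∈ E
  rw [hcs]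
  exact E.algebraMap_mem c

theorem Subalgebra.fg_of_le_of_isIntegral {k K : Type*} [Field k] [CommRing K] [Algebra k K]
    {A C : Subalgebra k K} (hAC : A ≤ C) (hC : C.FG) (h : ∀ c ∈ C, IsIntegral A c) : A.FG := by
  let _ := (Subalgebra.inclusion hAC).toAlgebra
  have : IsScalarTower k A C := .of_algebraMap_eq' rfl
  have : IsScalarTower A C K := .of_algebraMap_eq' rfl
  have : Algebra.FiniteType k C := Subalgebra.fg_iff_finiteType C |>.mp hC
  have hft : Algebra.FiniteType A C := .of_restrictScalars_finiteType k A C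
  have : Algebra.IsIntegral A C := ⟨fun c ↦
    (isIntegral_algebraMap_iff (B := K) Subtype.val_injective).mp (h c c.2)⟩
  have : Module.Finite A C := Algebra.IsIntegral.finite
  exact A.fg_iff_finiteType.mpr ⟨fg_of_fg_of_fg k A C (‹Algebra.FiniteType k C›.out)
    (Module.finite_def.mp ‹_›) (Subalgebra.inclusion_injective hAC)⟩

theorem Ring.krullDimLE_one_iff_of_isIntegral {B S : Type*} [CommRing B] [IsDomain B] [CommRing S]
    [IsDomain S] [Algebra B S] [FaithfulSMul B S] [Algebra.IsIntegral B S] :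
    Ring.KrullDimLE 1 B ↔ Ring.KrullDimLE 1 S := by
  rw [Ring.krullDimLE_one_iff_of_noZeroDivisors, Ring.krullDimLE_one_iff_of_noZeroDivisors]
  constructor
  · intro h Q hQ0 hQ
    exact Ideal.isMaximal_of_isIntegral_of_isMaximal_comap Q
      (h _ (Ideal.IsIntegral.comap_ne_bot B hQ0) inferInstance)
  · intro h P hP0 hP
    obtain ⟨Q, hQ, rfl⟩ := Ideal.exists_ideal_over_prime_of_isIntegral_of_isDomain (S := S) P (by
      simp [(RingHom.injective_iff_ker_eq_bot _).mp (FaithfulSMul.algebraMap_injective B S)])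
    have : Q.IsMaximal := h Q (by
      rintro rfl
      exact hP0 (Ideal.comap_bot_of_injective _ (FaithfulSMul.algebraMap_injective B S))) hQ
    exact Ideal.isMaximal_comap_of_isIntegral_of_isMaximal Q


theorem Ring.krullDimLE_one_iff_trdeg_le_one (k R : Type*) [Field k] [CommRing R] [IsDomain R]
    [Algebra k R] [Algebra.FiniteType k R] :
    Ring.KrullDimLE 1 R ↔ Algebra.trdeg k R ≤ 1 := by
  obtain ⟨s, g, hg, hgi⟩ := exists_integral_inj_algHom_of_fg k R
  algebraize [g.toRingHom]
  have : FaithfulSMul (MvPolynomial (Fin s) k) R :=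
    (faithfulSMul_iff_algebraMap_injective _ _).mpr hg
  have : IsScalarTower k (MvPolynomial (Fin s) k) R := .of_algebraMap_eq' g.comp_algebraMap.symm
  have h := lift_trdeg_add_eq k (MvPolynomial (Fin s) k) R
  rw [trdeg_eq_zero (R := MvPolynomial (Fin s) k), MvPolynomial.trdeg_of_isDomain] at h
  have h' : Algebra.trdeg k R = s := by
    simpa using h.symm
  rw [← Ring.krullDimLE_one_iff_of_isIntegral (B := MvPolynomial (Fin s) k), Ring.krullDimLE_iff,
    MvPolynomial.ringKrullDim_of_isNoetherianRing, h']
  simp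

theorem Subalgebra.fg_of_X_mem {k R : Type*} [Field k] [PerfectField k] [CommRing R] [IsDomain R]
    [Algebra k R] [Algebra.FiniteType k R] [Algebra k[X] R] [IsScalarTower k k[X] R]
    [FaithfulSMul k[X] R] [Algebra.IsAlgebraic k[X] R] (A : Subalgebra k R)
    (hA : algebraMap k[X] R X ∈ A) : A.FG := by
  classical
  let F := FractionRing k[X]
  let K := FractionRing R
  have : FaithfulSMul k[X] K := .trans k[X] R K
  let _ : Algebra F K := FractionRing.liftAlgebra k[X] K
  have : IsScalarTower k[X] F K := FractionRing.isScalarTower_liftAlgebra k[X] K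
  have : IsScalarTower k F K := .to₁₃₄ k k[X] F K
  have : Algebra.EssFiniteType R K := .of_isLocalization K (nonZeroDivisors R)
  have : Algebra.EssFiniteType k K := .comp k R K
  have : Algebra.EssFiniteType F K := .of_comp k F K
  have : Algebra.IsAlgebraic R K :=
    (IsFractionRing.comap_isAlgebraic_iff (A := R) (K := K) (C := K)).mpr inferInstance
  have : Algebra.IsAlgebraic k[X] K := .trans k[X] R K
  have : Algebra.IsAlgebraic F K := .extendScalars (IsFractionRing.injective k[X] F)
  have : FiniteDimensional F K := Algebra.finite_of_essFiniteType_of_isAlgebraic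
  obtain ⟨p, _⟩ := ExpChar.exists k
  have : ExpChar k[X] p := expChar_of_injective_algebraMap (algebraMap k k[X]).injective p
  let D := integralClosure k[X] K
  have : IsNoetherian k[X] D := isNoetherian_integralClosure_of_iterateFrobenius_finite k[X] F K p
    fun n ↦ iterateFrobenius_finite_of_finiteType k k[X] p n
  have : IsIntegrallyClosed D := integralClosure.isIntegrallyClosedOfFiniteExtension F
  have : IsNoetherianRing D := isNoetherian_of_tower k[X] ‹_›
  have : IsDedekindDomain D :=
    { toIsDomain := inferInstance, toIsDedekindRing := { } }
  have : IsFractionRing D K := IsIntegralClosure.isFractionRing_of_finite_extension k[X] F K D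
  obtain ⟨G, hG⟩ := ‹Algebra.FiniteType k R›.out
  obtain ⟨y, hy, hyG⟩ := Algebra.IsAlgebraic.exists_integral_multiples k[X]
    (G.image (algebraMap R K))
  have hpole (r : R) : ∃ n : ℕ, IsIntegral k[X] (y ^ n • algebraMap R K r) := by
    have hr : r ∈ Algebra.adjoin k (G : Set R) := hG ▸ Algebra.mem_top
    induction hr using Algebra.adjoin_induction with
    | mem r hr => exact ⟨1, by simpa using hyG _ (Finset.mem_image_of_mem _ hr)⟩
    | algebraMap c =>
      refine ⟨0, ?_⟩
      rw [pow_zero, one_smul, ← IsScalarTower.algebraMap_apply,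
        IsScalarTower.algebraMap_apply k k[X] K]
      exact isIntegral_algebraMap
    | add r s _ _ hr hs =>
      obtain ⟨m, hm⟩ := hr
      obtain ⟨n, hn⟩ := hs
      refine ⟨m + n, ?_⟩
      have h : y ^ (m + n) • algebraMap R K (r + s) = y ^ n • (y ^ m • algebraMap R K r) +
          y ^ m • (y ^ n • algebraMap R K s) := by
        simp only [map_add, smul_add, smul_smul, ← pow_add, add_comm]
      rw [h]
      exact (hm.smul _).add (hn.smul _)
    | mul r s _ _ hr hs =>
      obtain ⟨m, hm⟩ := hr
      obtain ⟨n, hn⟩ := hs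
      refine ⟨m + n, ?_⟩
      rw [map_mul, pow_add, ← smul_mul_smul_comm]
      exact hm.mul hn
  let ι : R →ₐ[k] K := IsScalarTower.toAlgHom k R K
  have hι : Function.Injective ι := IsFractionRing.injective R K
  refine Subalgebra.fg_of_fg_map A ι hι ?_
  set A' := A.map ι
  have hX : algebraMap k[X] K X ∈ A' :=
    ⟨_, hA, (IsScalarTower.algebraMap_apply k[X] R K X).symm⟩
  obtain ⟨S, hSA, hAS⟩ := IsDedekindDomain.exists_finset_subset_adjoin (D := D) (A' : Set K)
    (f := algebraMap k[X] D y) (by simpa using hy) (by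
      rintro _ ⟨r, -, rfl⟩
      obtain ⟨n, hn⟩ := hpole r
      refine ⟨n, ⟨_, hn⟩, ?_⟩
      rw [← map_pow, algebraMap_smul]
      rfl)
  have hDft : Algebra.FiniteType k D := .trans (S := k[X]) inferInstance inferInstance
  let C : Subalgebra k K := D.restrictScalars k ⊔ Algebra.adjoin k (S : Set K)
  have hDC (d : D) : (d : K) ∈ C := Algebra.mem_sup_left d.2
  refine Subalgebra.fg_of_le_of_isIntegral (C := C) (fun a ha ↦ ?_) ?_ fun c hc ↦ ?_
  · exact Algebra.adjoin_induction (p := fun x _ ↦ x ∈ C)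
      (fun s hs ↦ Algebra.mem_sup_right (Algebra.subset_adjoin hs)) hDC
      (fun _ _ _ _ ↦ C.add_mem) (fun _ _ _ _ ↦ C.mul_mem) (hAS ha)
  · exact .sup ((D.restrictScalars k).fg_iff_finiteType.mpr hDft) ⟨S, rfl⟩
  · let _ := (aeval (R := k) (⟨_, hX⟩ : A')).toAlgebra
    have h : IsScalarTower.toAlgHom k k[X] K = A'.val.comp (aeval ⟨_, hX⟩) := by
      ext
      simp
    have : IsScalarTower k[X] A' K := .of_algebraMap_eq fun q ↦ DFunLike.congr_fun h q
    have : C ≤ (integralClosure A' K).restrictScalars k := by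
      refine sup_le (fun d hd ↦ IsIntegral.tower_top hd) (Algebra.adjoin_le fun s hs ↦ ?_)
      exact isIntegral_algebraMap (x := (⟨s, hSA hs⟩ : A'))
    exact this hc

theorem subalgebra_of_one_dimensional_affine_domain
    {k R : Type*} [Field k] [IsAlgClosed k] [CommRing R] [IsDomain R]
    [Algebra k R] [Algebra.FiniteType k R] (hdim : ringKrullDim R = 1)
    (A : Subalgebra k R) :
    A = ⊥ ∨ (IsDomain ↥A ∧ Algebra.FiniteType k ↥A ∧ ringKrullDim ↥A = 1) := by
  refine or_iff_not_imp_left.mpr fun hA ↦ ⟨inferInstance, ?_⟩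
  have htr : Algebra.trdeg k R ≤ 1 :=
    (Ring.krullDimLE_one_iff_trdeg_le_one k R).mp (Ring.krullDimLE_iff.mpr hdim.le)
  have halg : ¬ Algebra.IsAlgebraic k A := fun h ↦ hA <| by
    have hs := (IsAlgClosed.algebraMap_bijective_of_isIntegral (k := k) (K := A)).2
    refine eq_bot_iff.mpr fun a ha ↦ ?_
    obtain ⟨c, hc⟩ := hs ⟨a, ha⟩
    exact ⟨c, congrArg Subtype.val hc⟩
  have hft : Algebra.FiniteType k A := by
    obtain ⟨t, ht⟩ := Algebra.transcendental_iff_not_isAlgebraic.mpr halg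
    have htR : Transcendental k (t : R) := by
      rwa [Transcendental, ← A.coe_val, isAlgebraic_algHom_iff A.val Subtype.val_injective]
    let _ := (aeval (R := k) (t : R)).toAlgebra
    have : IsScalarTower k k[X] R := .of_algebraMap_eq' (aeval (t : R)).comp_algebraMap.symm
    have : FaithfulSMul k[X] R := (faithfulSMul_iff_algebraMap_injective _ _).mpr
      (transcendental_iff_injective.mp htR)
    have : Algebra.IsAlgebraic k[X] R := by
      rw [← trdeg_eq_zero_iff]
      have h := (lift_trdeg_add_eq k k[X] R).trans_le (Cardinal.lift_le.mpr htr)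
      rw [Polynomial.trdeg_of_isDomain, Cardinal.lift_one, Cardinal.lift_one, add_comm,
        ← zero_add (1 : Cardinal), ← add_assoc, add_zero,
        Cardinal.add_le_add_iff_of_lt_aleph0 Cardinal.one_lt_aleph0] at h
      simpa using h
    refine A.fg_iff_finiteType.mp (A.fg_of_X_mem ?_)
    change aeval (t : R) X ∈ A
    simp
  refine ⟨hft, eq_of_le_of_not_lt ?_ fun h ↦ halg ?_⟩
  · rw [← Nat.cast_one, ← Ring.krullDimLE_iff, Ring.krullDimLE_one_iff_trdeg_le_one k]
    exact (trdeg_le_of_injective A.val Subtype.val_injective).trans htr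
  · have h' : ringKrullDim A ≤ 0 := Order.le_of_lt_succ h
    rw [← Nat.cast_zero, ← Ring.krullDimLE_iff] at h'
    let _ := (Ring.KrullDimLE.isField_of_isDomain (R := A)).toField
    have : Module.Finite k A := finite_of_finite_type_of_isJacobsonRing k A
    infer_instance
end

section
/- Let k be an algebraically closed field and let R = k[t, t^{−1}, y] be the polynomial ring in y over the Laurent polynomial ring k[t, t^{−1}]. Let A be an extending maximal k-subalgebra of R. Then exactly one of the following holds: (i) there exists a k-algebra automorphism σ of R such that σ(A) contains the k-subalgebra k[t, y] generated by t and y; (ii) A contains the k-subalgebra k[t, t^{−1}] of Laurent polynomials (constant in y). -/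
/-- `A` is an extending maximal `k`-subalgebra of `R`: a maximal `k`-subalgebra
admitting a maximal ideal whose extension to `R` is the unit ideal. -/
def IsExtendingMaximalSubalgebra (k : Type*) {R : Type*} [CommSemiring k] [CommRing R]
    [Algebra k R] (A : Subalgebra k R) : Prop :=
  A ≠ ⊤ ∧ (∀ B : Subalgebra k R, A < B → B = ⊤) ∧
    ∃ m : Ideal ↥A, m.IsMaximal ∧ Ideal.map (A.val : ↥A →ₐ[k] R) m = ⊤

open Polynomial in
/-- If `u` is inverse to a root `v` of `p`, then `p.coeff 0 • u` is integral. -/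
theorem isIntegral_coeff_zero_smul_of_mul_eq_one {S R : Type*} [CommRing S] [CommRing R]
    [Algebra S R] {u v : R} (huv : u * v = 1) {p : S[X]} (hp : aeval v p = 0)
    (h0 : p.coeff 0 ≠ 0) : IsIntegral S (p.coeff 0 • u) := by
  let _ : Invertible v := ⟨u, huv, by rw [mul_comm, huv]⟩
  have hrev : aeval u p.reverse = 0 := (eval₂_reverse_eq_zero_iff (algebraMap S R) v p).2 hp
  have h := isIntegral_leadingCoeff_smul p.reverse u hrev
  rwa [reverse_leadingCoeff, trailingCoeff_eq_coeff_zero h0] at h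

open Polynomial in
/-- An element of the extension of `I` to `S[x]` is the value at `x` of a polynomial with
coefficients in `I`. -/
theorem exists_aeval_eq_of_mem_map {S R : Type*} [CommRing S] [CommRing R] [Algebra S R]
    {x : R} (hx : Algebra.adjoin S {x} = ⊤) {I : Ideal S} {r : R}
    (hr : r ∈ I.map (algebraMap S R)) :
    ∃ p : S[X], (∀ n, p.coeff n ∈ I) ∧ aeval x p = r := by
  have hsurj : Function.Surjective (aeval x : S[X] →ₐ[S] R) := by
    rwa [← AlgHom.range_eq_top, ← Algebra.adjoin_singleton_eq_range_aeval]
  have hcomp : algebraMap S R = (aeval x : S[X] →ₐ[S] R).toRingHom.comp (C : S →+* S[X]) := by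
    ext s; simp
  rw [hcomp, ← Ideal.map_map] at hr
  obtain ⟨p, hp, rfl⟩ := (Ideal.mem_map_iff_of_surjective _ hsurj).1 hr
  exact ⟨p, Ideal.mem_map_C_iff.1 hp, rfl⟩

/-- If `c * x` lies in the image of `S`, then powers of `c` clear denominators in `S[x]`. -/
theorem exists_pow_mul_eq_algebraMap {S R : Type*} [CommRing S] [CommRing R] [Algebra S R]
    {c b : S} {x : R} (hb : algebraMap S R c * x = algebraMap S R b) {r : R}
    (hr : r ∈ Algebra.adjoin S {x}) :
    ∃ (n : ℕ) (a : S), algebraMap S R c ^ n * r = algebraMap S R a := by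
  induction hr using Algebra.adjoin_induction with
  | mem y hy => obtain rfl := hy; exact ⟨1, b, by simpa using hb⟩
  | algebraMap s => exact ⟨0, s, by simp⟩
  | add y z _ _ hy hz =>
    obtain ⟨n, a, ha⟩ := hy
    obtain ⟨n', a', ha'⟩ := hz
    refine ⟨n + n', c ^ n' * a + c ^ n * a', ?_⟩
    simp only [map_add, map_mul, map_pow, ← ha, ← ha']
    ring
  | mul y z _ _ hy hz =>
    obtain ⟨n, a, ha⟩ := hy
    obtain ⟨n', a', ha'⟩ := hz
    refine ⟨n + n', a * a', ?_⟩
    simp only [map_mul, ← ha, ← ha']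
    ring

/-- If powers of `c` carry every element of `R` into `S`, then powers of `c` carry the extension
of an ideal `I` into the image of `I`. -/
theorem exists_pow_mul_eq_algebraMap_of_mem_map {S R : Type*} [CommRing S] [CommRing R]
    [Algebra S R] {c : S}
    (hc : ∀ r : R, ∃ (n : ℕ) (a : S), algebraMap S R c ^ n * r = algebraMap S R a)
    {I : Ideal S} {r : R} (hr : r ∈ I.map (algebraMap S R)) :
    ∃ n : ℕ, ∃ a ∈ I, algebraMap S R c ^ n * r = algebraMap S R a := by
  induction hr using Submodule.span_induction with
  | mem y hy => obtain ⟨a, ha, rfl⟩ := hy; exact ⟨0, a, ha, by simp⟩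
  | zero => exact ⟨0, 0, I.zero_mem, by simp⟩
  | add y z _ _ hy hz =>
    obtain ⟨n, a, haI, ha⟩ := hy
    obtain ⟨n', a', haI', ha'⟩ := hz
    refine ⟨n + n', c ^ n' * a + c ^ n * a',
      I.add_mem (I.mul_mem_left _ haI) (I.mul_mem_left _ haI'), ?_⟩
    simp only [map_add, map_mul, map_pow, ← ha, ← ha']
    ring
  | smul s y _ hy =>
    obtain ⟨n, a, haI, ha⟩ := hy
    obtain ⟨n', a', ha'⟩ := hc s
    refine ⟨n + n', a' * a, I.mul_mem_left _ haI, ?_⟩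
    simp only [map_mul, ← ha, ← ha', smul_eq_mul]
    ring

section Maximal

variable {k R : Type*} [CommRing k] [CommRing R] [Algebra k R] {A : Subalgebra k R}

/-- A maximal subalgebra together with any outside element generates the whole ring. -/
theorem adjoin_singleton_eq_top_of_notMem (hmax : ∀ B : Subalgebra k R, A < B → B = ⊤)
    {x : R} (hx : x ∉ A) : Algebra.adjoin A {x} = ⊤ := by
  have hlt : A < (Algebra.adjoin A {x}).restrictScalars k := by
    refine lt_of_le_of_ne (fun a ha => ?_) fun h => hx ?_
    · exact (Algebra.adjoin A {x}).algebraMap_mem ⟨a, ha⟩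
    · rw [h]
      exact Algebra.self_mem_adjoin_singleton A x
  rw [Algebra.eq_top_iff]
  intro r
  have hr : r ∈ (Algebra.adjoin A {x}).restrictScalars k := by
    rw [hmax _ hlt]
    exact Algebra.mem_top
  exact hr

/-- An extending maximal subalgebra is integrally closed. -/
theorem IsExtendingMaximalSubalgebra.mem_of_isIntegral
    (hA : IsExtendingMaximalSubalgebra k A) {x : R} (hx : IsIntegral A x) : x ∈ A := by
  obtain ⟨-, hmax, m, hm, hmR⟩ := hA
  by_contra hxA
  have hint : Algebra.IsIntegral A R := by
    refine ⟨fun r => adjoin_le_integralClosure hx ?_⟩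
    rw [adjoin_singleton_eq_top_of_notMem hmax hxA]
    exact Algebra.mem_top
  exact hm.ne_top ((Ideal.map_eq_top_iff (algebraMap A R) Subtype.val_injective
    (algebraMap_isIntegral_iff.2 hint)).1 hmR)

/-- An extending maximal subalgebra contains every unit or its inverse. -/
theorem IsExtendingMaximalSubalgebra.mem_or_mem_of_mul_eq_one
    (hA : IsExtendingMaximalSubalgebra k A) {u v : R} (huv : u * v = 1) : u ∈ A ∨ v ∈ A := by
  by_contra! h
  obtain ⟨hu, hv⟩ := h
  obtain ⟨-, hmax, m, hm, hmR⟩ := id hA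
  have hone : (1 : R) ∈ m.map (algebraMap A R) := by
    rw [Ideal.eq_top_iff_one] at hmR
    exact hmR
  obtain ⟨p, hp, hp1⟩ :=
    exists_aeval_eq_of_mem_map (adjoin_singleton_eq_top_of_notMem hmax hv) hone
  have hc : (1 - p).coeff 0 ∉ m := fun h => by
    rw [Polynomial.coeff_sub, Polynomial.coeff_one_zero] at h
    exact hm.ne_top ((Ideal.eq_top_iff_one m).2 (by simpa using m.add_mem h (hp 0)))
  have hmem := hA.mem_of_isIntegral
    (isIntegral_coeff_zero_smul_of_mul_eq_one (p := 1 - p) huv (by simp [hp1])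
      fun h0 => hc (h0 ▸ m.zero_mem))
  obtain ⟨n, a, ha, hna⟩ := exists_pow_mul_eq_algebraMap_of_mem_map
    (c := (1 - p).coeff 0) (fun r => exists_pow_mul_eq_algebraMap (b := ⟨_, hmem⟩)
      (Algebra.smul_def _ _).symm (by
        rw [adjoin_singleton_eq_top_of_notMem hmax hu]
        exact Algebra.mem_top)) hone
  rw [mul_one, ← map_pow] at hna
  have hpow : (1 - p).coeff 0 ^ n = a := Subtype.val_injective hna
  exact hc (hm.isPrime.mem_of_pow_mem n (hpow ▸ ha))

/-- If a maximal subalgebra contains `u` but not its inverse `v`, every element of the ring is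
carried into it by a power of `u`. -/
theorem exists_pow_mul_mem_of_mul_eq_one (hmax : ∀ B : Subalgebra k R, A < B → B = ⊤)
    {u v : R} (huv : u * v = 1) (hu : u ∈ A) (hv : v ∉ A) (r : R) : ∃ n : ℕ, u ^ n * r ∈ A := by
  obtain ⟨n, a, ha⟩ := exists_pow_mul_eq_algebraMap (S := A) (c := ⟨u, hu⟩) (b := 1) (x := v)
    (r := r) (by simpa using huv) (by
      rw [adjoin_singleton_eq_top_of_notMem hmax hv]
      exact Algebra.mem_top)
  refine ⟨n, ?_⟩
  have ha' : u ^ n * r = a := ha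
  exact ha' ▸ a.2

end Maximal

/-- The Laurent polynomials constant in the polynomial variable are generated by `T 1` and
`T (-1)`. -/
theorem C_mem_adjoin_T {k : Type*} [Field k] (f : LaurentPolynomial k) :
    (Polynomial.C f : Polynomial (LaurentPolynomial k)) ∈ Algebra.adjoin k
      {Polynomial.C (LaurentPolynomial.T 1), Polynomial.C (LaurentPolynomial.T (-1))} := by
  set B : Subalgebra k (Polynomial (LaurentPolynomial k)) := Algebra.adjoin k
      {Polynomial.C (LaurentPolynomial.T 1), Polynomial.C (LaurentPolynomial.T (-1))}
  have h1 : Polynomial.C (LaurentPolynomial.T 1) ∈ B := Algebra.subset_adjoin (by simp)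
  have h2 : Polynomial.C (LaurentPolynomial.T (-1)) ∈ B := Algebra.subset_adjoin (by simp)
  induction f using LaurentPolynomial.induction_on with
  | h_C a => exact B.algebraMap_mem a
  | h_add hp hq => rw [map_add]; exact B.add_mem hp hq
  | h_C_mul_T n a h =>
    rw [LaurentPolynomial.T_add, ← mul_assoc, map_mul]
    exact B.mul_mem h h1
  | h_C_mul_T_Z n a h =>
    rw [sub_eq_add_neg, LaurentPolynomial.T_add, ← mul_assoc, map_mul]
    exact B.mul_mem h h2

/-- Multiplying the polynomial variable by `T n` is an automorphism. -/
theorem exists_algEquiv_C_T_mul_X {k : Type*} [Field k] (n : ℤ) :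
    ∃ σ : Polynomial (LaurentPolynomial k) ≃ₐ[k] Polynomial (LaurentPolynomial k),
      (∀ f, σ (Polynomial.C f) = Polynomial.C f) ∧
        σ (Polynomial.C (LaurentPolynomial.T n) * Polynomial.X) = Polynomial.X := by
  refine ⟨(Polynomial.algEquivCMulXAddC (LaurentPolynomial.T (-n)) 0).restrictScalars k,
    fun f => ?_, ?_⟩
  · simp
  · have h : (Polynomial.C (LaurentPolynomial.T n) : Polynomial (LaurentPolynomial k)) *
        Polynomial.C (LaurentPolynomial.T (-n)) = 1 := by
      rw [← map_mul, ← LaurentPolynomial.T_add]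
      simp
    simp [← mul_assoc, h]

/-- A subalgebra containing `T 1` and `T n * X` contains `k[t, y]` up to an automorphism. -/
theorem exists_adjoin_le_map_of_mem {k : Type*} [Field k]
    {A : Subalgebra k (Polynomial (LaurentPolynomial k))} (n : ℤ)
    (hT : Polynomial.C (LaurentPolynomial.T 1) ∈ A)
    (hX : Polynomial.C (LaurentPolynomial.T n) * Polynomial.X ∈ A) :
    ∃ σ : Polynomial (LaurentPolynomial k) ≃ₐ[k] Polynomial (LaurentPolynomial k),
      Algebra.adjoin k
          {Polynomial.C (LaurentPolynomial.T 1),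
            (Polynomial.X : Polynomial (LaurentPolynomial k))} ≤ A.map σ.toAlgHom := by
  obtain ⟨σ, hσC, hσX⟩ := exists_algEquiv_C_T_mul_X (k := k) n
  refine ⟨σ, Algebra.adjoin_le ?_⟩
  rintro _ (rfl | rfl)
  · exact ⟨_, hT, hσC _⟩
  · exact ⟨_, hX, hσX⟩

/-- A proper subalgebra containing `k[t, t⁻¹]` does not contain `k[t, y]` up to an
automorphism. -/
theorem not_adjoin_le_map_of_adjoin_le {k : Type*} [Field k]
    {A : Subalgebra k (Polynomial (LaurentPolynomial k))} (hA : A ≠ ⊤)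
    (hT : Algebra.adjoin k {Polynomial.C (LaurentPolynomial.T 1),
      Polynomial.C (LaurentPolynomial.T (-1))} ≤ A)
    (σ : Polynomial (LaurentPolynomial k) ≃ₐ[k] Polynomial (LaurentPolynomial k)) :
    ¬ Algebra.adjoin k
        {Polynomial.C (LaurentPolynomial.T 1),
          (Polynomial.X : Polynomial (LaurentPolynomial k))} ≤ A.map σ.toAlgHom := by
  intro h
  have hunit : ∀ n : ℤ, Polynomial.C (LaurentPolynomial.T n) ∈ A.map σ.toAlgHom := fun n => by
    have hu : IsUnit (σ.symm (Polynomial.C (LaurentPolynomial.T n))) :=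
      ((LaurentPolynomial.isUnit_T n).map Polynomial.C).map σ.symm
    obtain ⟨f, -, hf⟩ := Polynomial.isUnit_iff.1 hu
    exact ⟨_, hT (C_mem_adjoin_T f), by simp [hf]⟩
  have hC : ∀ f, Polynomial.C f ∈ A.map σ.toAlgHom := fun f =>
    Algebra.adjoin_le (by rintro _ (rfl | rfl) <;> exact hunit _) (C_mem_adjoin_T f)
  have hX : Polynomial.X ∈ A.map σ.toAlgHom := h (Algebra.subset_adjoin (by simp))
  refine hA (Algebra.eq_top_iff.2 fun r => ?_)
  have hr : σ r ∈ A.map σ.toAlgHom := by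
    induction σ r using Polynomial.induction_on with
    | C a => exact hC a
    | add p q hp hq => exact add_mem hp hq
    | monomial n a _ => exact mul_mem (hC a) (pow_mem hX _)
  obtain ⟨a, ha, har⟩ := hr
  exact σ.injective har ▸ ha

/-- In `R = k[t,t⁻¹,y] = (k[t,t⁻¹])[y]`, any extending maximal `k`-subalgebra either
becomes one containing `k[t,y]` after an automorphism of `R`, or contains `k[t,t⁻¹]`
(and exactly one of the two cases occurs). -/
theorem extending_maximal_subalgebras_of_laurent_times_affine
    {k : Type*} [Field k] [IsAlgClosed k]
    (A : Subalgebra k (Polynomial (LaurentPolynomial k)))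
    (hA : IsExtendingMaximalSubalgebra k A) :
    Xor'
      (∃ σ : Polynomial (LaurentPolynomial k) ≃ₐ[k] Polynomial (LaurentPolynomial k),
        Algebra.adjoin k
            {Polynomial.C (LaurentPolynomial.T 1), (Polynomial.X : Polynomial (LaurentPolynomial k))} ≤
          A.map σ.toAlgHom)
      (Algebra.adjoin k
          {Polynomial.C (LaurentPolynomial.T 1), Polynomial.C (LaurentPolynomial.T (-1))} ≤ A) := by
  have huv : (Polynomial.C (LaurentPolynomial.T 1) : Polynomial (LaurentPolynomial k)) *
      Polynomial.C (LaurentPolynomial.T (-1)) = 1 := by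
    rw [← map_mul, ← LaurentPolynomial.T_add]
    simp
  by_cases h : Algebra.adjoin k {Polynomial.C (LaurentPolynomial.T 1),
      Polynomial.C (LaurentPolynomial.T (-1))} ≤ A
  · exact Or.inr ⟨h, fun ⟨σ, hσ⟩ => not_adjoin_le_map_of_adjoin_le hA.1 h σ hσ⟩
  · refine Or.inl ⟨?_, h⟩
    by_cases hu : Polynomial.C (LaurentPolynomial.T 1) ∈ A
    · have hv : Polynomial.C (LaurentPolynomial.T (-1)) ∉ A := fun hv =>
        h (Algebra.adjoin_le (by rintro _ (rfl | rfl) <;> assumption))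
      obtain ⟨n, hn⟩ := exists_pow_mul_mem_of_mul_eq_one hA.2.1 huv hu hv Polynomial.X
      rw [← map_pow, LaurentPolynomial.T_pow] at hn
      exact exists_adjoin_le_map_of_mem _ hu hn
    · have hv := (hA.mem_or_mem_of_mul_eq_one huv).resolve_left hu
      obtain ⟨n, hn⟩ :=
        exists_pow_mul_mem_of_mul_eq_one hA.2.1 (mul_comm _ _ |>.trans huv) hv hu Polynomial.X
      rw [← map_pow, LaurentPolynomial.T_pow] at hn
      let τ : Polynomial (LaurentPolynomial k) ≃ₐ[k] Polynomial (LaurentPolynomial k) :=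
        Polynomial.mapAlgEquiv LaurentPolynomial.invert
      obtain ⟨σ, hσ⟩ := exists_adjoin_le_map_of_mem (A := A.map τ.toAlgHom) (-(n * -1))
        ⟨_, hv, by simp [τ]⟩ ⟨_, hn, by simp [τ]⟩
      exact ⟨τ.trans σ, hσ.trans_eq (Subalgebra.map_map A σ.toAlgHom τ.toAlgHom)⟩
end

section
/- Let k be an algebraically closed field and let R = k[t, t^{−1}, y] be the polynomial ring in y over the Laurent polynomial ring k[t, t^{−1}], with k[t, y] the k-subalgebra generated by t and y, k[t, t^{−1}] the k-subalgebra of Laurent polynomials constant in y, and k[t] the k-subalgebra generated by t. Then the assignment A ↦ A ∩ k[t, y] is a bijection from the set of extending maximal k-subalgebras of R that contain k[t, t^{−1}] onto the set of extending maximal k-subalgebras A' of k[t, y] that contain k[t] and whose crucial maximal ideal does not contain t (i.e., there is a maximal ideal 𝔪 of A' with 𝔪·k[t, y] = k[t, y] and t ∉ 𝔪). -/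
/-- `A` is an extending maximal `k`-subalgebra of the intermediate `k`-subalgebra `T`. -/
def IsExtendingMaximalSubalgebraIn (k : Type*) {R : Type*} [CommSemiring k] [CommRing R]
    [Algebra k R] (A T : Subalgebra k R) : Prop :=
  ∃ h : A ≤ T, A ≠ T ∧ (∀ B : Subalgebra k R, A < B → B ≤ T → B = T) ∧
    ∃ m : Ideal ↥A, m.IsMaximal ∧ Ideal.map (Subalgebra.inclusion h) m = ⊤

section General

variable {k R : Type*} [Field k] [CommRing R] [Algebra k R]

/-- Elements which some power of `t` multiplies into the subalgebra `A`. -/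
def Subalgebra.powSaturation (A : Subalgebra k R) (t : R) (ht : t ∈ A) : Subalgebra k R where
  carrier := {r | ∃ n : ℕ, t ^ n * r ∈ A}
  mul_mem' := by
    rintro a b ⟨n, hn⟩ ⟨m, hm⟩
    refine ⟨n + m, ?_⟩
    have := A.mul_mem hn hm
    rwa [show t ^ n * a * (t ^ m * b) = t ^ (n + m) * (a * b) by ring] at this
  add_mem' := by
    rintro a b ⟨n, hn⟩ ⟨m, hm⟩
    refine ⟨n + m, ?_⟩
    have := A.add_mem (A.mul_mem (A.pow_mem ht m) hn) (A.mul_mem (A.pow_mem ht n) hm)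
    rwa [show t ^ m * (t ^ n * a) + t ^ n * (t ^ m * b) = t ^ (n + m) * (a + b) by ring] at this
  algebraMap_mem' r := ⟨0, by simp [A.algebraMap_mem]⟩

theorem Subalgebra.mem_powSaturation {A : Subalgebra k R} {t : R} {ht : t ∈ A} {r : R} :
    r ∈ A.powSaturation t ht ↔ ∃ n : ℕ, t ^ n * r ∈ A := Iff.rfl

theorem Subalgebra.le_powSaturation (A : Subalgebra k R) (t : R) (ht : t ∈ A) :
    A ≤ A.powSaturation t ht := fun a ha => ⟨0, by simpa using ha⟩

theorem Subalgebra.mem_of_pow_mul_mem {A : Subalgebra k R} {t s : R} (hs : s ∈ A)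
    (hst : s * t = 1) {n : ℕ} {r : R} (h : t ^ n * r ∈ A) : r ∈ A := by
  have := A.mul_mem (A.pow_mem hs n) h
  rwa [← mul_assoc, ← mul_pow, hst, one_pow, one_mul] at this

theorem Ideal.map_induction {S S' : Type*} [CommRing S] [CommRing S'] (f : S →+* S')
    {I : Ideal S} {P : S' → Prop} (h_zero : P 0) (h_add : ∀ x y, P x → P y → P (x + y))
    (h_mul : ∀ a ∈ I, ∀ r, P (r * f a)) {x : S'} (hx : x ∈ I.map f) : P x := by
  have key : ∀ r, P (r * x) := by
    refine Submodule.span_induction (p := fun x _ => ∀ r, P (r * x)) ?_ ?_ ?_ ?_ hx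
    · rintro _ ⟨a, ha, rfl⟩ r
      exact h_mul a ha r
    · simpa using h_zero
    · intro x y _ _ h1 h2 r
      rw [mul_add]
      exact h_add _ _ (h1 r) (h2 r)
    · intro a x _ h r
      rw [smul_eq_mul, ← mul_assoc]
      exact h _
  simpa using key 1

theorem Ideal.mem_of_map_eq_top_of_pow_mul_mem_range {S S' : Type*} [CommRing S] [CommRing S']
    {f : S →+* S'} (hf : Function.Injective f) {m : Ideal S} (hm : m.IsPrime)
    (htop : m.map f = ⊤) (t : S) (h : ∀ r, ∃ n : ℕ, ∃ s, f s = f t ^ n * r) : t ∈ m := by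
  have h1 : (1 : S') ∈ m.map f := by simp [htop]
  have : ∃ n : ℕ, ∃ a ∈ m, f a = f t ^ n * 1 := by
    refine Ideal.map_induction f (P := fun x => ∃ n : ℕ, ∃ a ∈ m, f a = f t ^ n * x)
      ⟨0, 0, m.zero_mem, by simp⟩ ?_ ?_ h1
    · rintro x y ⟨n, a, ha, hx⟩ ⟨n', a', ha', hy⟩
      refine ⟨n + n', t ^ n' * a + t ^ n * a',
        m.add_mem (m.mul_mem_left _ ha) (m.mul_mem_left _ ha'), ?_⟩
      simp only [map_add, map_mul, map_pow, hx, hy]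
      ring
    · intro a ha r
      obtain ⟨n, s, hs⟩ := h r
      exact ⟨n, s * a, m.mul_mem_left _ ha, by rw [map_mul, hs, mul_assoc]⟩
  obtain ⟨n, a, ha, hn⟩ := this
  rw [mul_one, ← map_pow] at hn
  exact hm.mem_of_pow_mem n (hf hn ▸ ha)

theorem Subalgebra.mem_of_powSaturation_eq_top {A : Subalgebra k R} {m : Ideal A}
    (hm : m.IsPrime) (htop : m.map (A.val : A →ₐ[k] R) = ⊤) {c : R} (hc : c ∈ A)
    (h : A.powSaturation c hc = ⊤) : (⟨c, hc⟩ : A) ∈ m := by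
  refine Ideal.mem_of_map_eq_top_of_pow_mul_mem_range (f := (A.val : A →ₐ[k] R).toRingHom)
    Subtype.val_injective hm htop _ fun r => ?_
  obtain ⟨n, hn⟩ : r ∈ A.powSaturation c hc := h ▸ Algebra.mem_top
  exact ⟨n, ⟨_, hn⟩, rfl⟩

theorem Subalgebra.mem_of_isIntegral_of_maximal {A : Subalgebra k R}
    (hmax : ∀ B : Subalgebra k R, A < B → B = ⊤) {m : Ideal A} (hm : m.IsMaximal)
    (htop : m.map (A.val : A →ₐ[k] R) = ⊤) {x : R} (hx : IsIntegral A x) : x ∈ A := by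
  by_contra hxA
  have hlt : A < (integralClosure A R).restrictScalars k := by
    refine lt_of_le_of_ne (fun a ha => ?_) ?_
    · exact isIntegral_algebraMap (R := A) (x := (⟨a, ha⟩ : A))
    · intro h
      apply hxA
      rw [h]
      exact hx
  have hall := hmax _ hlt
  have : Algebra.IsIntegral A R := ⟨fun y => by
    have : y ∈ (integralClosure A R).restrictScalars k := hall ▸ Algebra.mem_top
    exact this⟩
  obtain ⟨Q, hQ, hQm⟩ := Ideal.exists_ideal_over_maximal_of_isIntegral (S := R) m
    (by
      rw [(RingHom.injective_iff_ker_eq_bot _).1 (Subtype.val_injective :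
        Function.Injective (algebraMap A R))]
      exact bot_le)
  refine hQ.ne_top (top_le_iff.1 (htop ▸ ?_))
  exact Ideal.map_le_iff_le_comap.2 hQm.ge

theorem Subalgebra.exists_pow_mul_mem_of_maximal {A : Subalgebra k R}
    (hmax : ∀ B : Subalgebra k R, A < B → B = ⊤) {m : Ideal A} (hm : m.IsMaximal)
    (htop : m.map (A.val : A →ₐ[k] R) = ⊤) {u : A} (hu : u ∈ m) (r : R) :
    ∃ n : ℕ, (u : R) ^ n * r ∈ A := by
  by_cases hsat : A = A.powSaturation u u.2
  · exfalso
    have hdiv : ∀ r, (u : R) * r ∈ A → r ∈ A := fun r hr => by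
      rw [hsat]
      exact ⟨1, by simpa using hr⟩
    let B : Subalgebra k R :=
      { carrier := {x | ∃ a ∈ A, ∃ s, x = a + u * s}
        mul_mem' := by
          rintro _ _ ⟨a, ha, s, rfl⟩ ⟨b, hb, s', rfl⟩
          exact ⟨a * b, A.mul_mem ha hb, a * s' + s * b + u * s * s', by ring⟩
        add_mem' := by
          rintro _ _ ⟨a, ha, s, rfl⟩ ⟨b, hb, s', rfl⟩
          exact ⟨a + b, A.add_mem ha hb, s + s', by ring⟩
        algebraMap_mem' := fun c => ⟨algebraMap k R c, A.algebraMap_mem c, 0, by simp⟩ }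
    have hAB : A ≤ B := fun a ha => ⟨a, ha, 0, by simp⟩
    have hB : B = ⊤ := by
      rcases hAB.lt_or_eq with h | h
      · exact hmax B h
      · have hA : A = ⊤ := by
          refine top_le_iff.1 fun r _ => hdiv r ?_
          refine h.ge ?_
          exact ⟨0, A.zero_mem, r, by simp⟩
        rw [← h, hA]
    have h1 : (1 : R) ∈ m.map (A.val : A →ₐ[k] R) := by simp [htop]
    have : ∃ a ∈ m, ∃ s, (1 : R) = a + u * s := by
      refine Ideal.map_induction (A.val : A →ₐ[k] R).toRingHom
        (P := fun x => ∃ a ∈ m, ∃ s, x = (a : R) + u * s) ⟨0, m.zero_mem, 0, by simp⟩ ?_ ?_ h1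
      · rintro _ _ ⟨a, ha, s, rfl⟩ ⟨b, hb, s', rfl⟩
        exact ⟨a + b, m.add_mem ha hb, s + s', by push_cast; ring⟩
      · intro a ha r
        obtain ⟨b, hb, s, rfl⟩ : r ∈ B := hB ▸ Algebra.mem_top
        refine ⟨⟨b, hb⟩ * a, m.mul_mem_left _ ha, s * a, ?_⟩
        change (b + u * s) * (a : R) = b * a + u * (s * a)
        ring
    obtain ⟨a, ha, s, hs⟩ := this
    have hsA : s ∈ A := hdiv s (by
      rw [show (u : R) * s = 1 - a by rw [hs]; ring]
      exact A.sub_mem A.one_mem a.2)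
    apply hm.ne_top
    rw [Ideal.eq_top_iff_one]
    have : (1 : A) = a + u * ⟨s, hsA⟩ := Subtype.ext (by simpa using hs)
    rw [this]
    exact m.add_mem ha (m.mul_mem_right _ hu)
  · have := hmax _ ((A.le_powSaturation u u.2).lt_of_ne hsat)
    have hr : r ∈ A.powSaturation u u.2 := this ▸ Algebra.mem_top
    exact hr

theorem Subalgebra.powSaturation_inf_eq {A T : Subalgebra k R} {t s : R} (hst : s * t = 1)
    (hs : s ∈ A) (htA : t ∈ A) (htT : t ∈ T) (hT : T.powSaturation t htT = ⊤) :
    (A ⊓ T).powSaturation t ⟨htA, htT⟩ = A := by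
  ext r
  constructor
  · rintro ⟨n, hn⟩
    exact mem_of_pow_mul_mem hs hst hn.1
  · intro hr
    obtain ⟨n, hn⟩ : r ∈ T.powSaturation t htT := hT ▸ Algebra.mem_top
    exact ⟨n, A.mul_mem (A.pow_mem htA n) hr, hn⟩

theorem Subalgebra.eq_top_of_le_of_powSaturation_eq_top {A T : Subalgebra k R} {t s : R}
    (hst : s * t = 1) (hs : s ∈ A) (htT : t ∈ T) (hT : T.powSaturation t htT = ⊤) (h : T ≤ A) :
    A = ⊤ := by
  refine top_le_iff.1 fun r _ => ?_
  obtain ⟨n, hn⟩ : r ∈ T.powSaturation t htT := hT ▸ Algebra.mem_top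
  exact mem_of_pow_mul_mem hs hst (h hn)

theorem Subalgebra.mem_of_isCoprime_pow_mul_mem {B : Subalgebra k R} {t u a b f : R} {n l : ℕ}
    (ht : t ∈ B) (hu : u ∈ B) (ha : a ∈ B) (hb : b ∈ B) (hab : a * t + b * u = 1)
    (hn : t ^ n * f ∈ B) (hl : u ^ l * f ∈ B) : f ∈ B := by
  have hco : IsCoprime (⟨t, ht⟩ : B) ⟨u, hu⟩ := ⟨⟨a, ha⟩, ⟨b, hb⟩, Subtype.ext hab⟩
  obtain ⟨a', b', h⟩ := hco.pow (m := n) (n := l)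
  have h' : (a' : R) * t ^ n + b' * u ^ l = 1 := congrArg Subtype.val h
  have := B.add_mem (B.mul_mem a'.2 hn) (B.mul_mem b'.2 hl)
  rwa [← mul_assoc, ← mul_assoc, ← add_mul, h', one_mul] at this

theorem isExtendingMaximalSubalgebra_powSaturation {A' T : Subalgebra k R} {t s : R}
    (hst : s * t = 1) (htT : t ∈ T) (hT : T.powSaturation t htT = ⊤) (h : A' ≤ T) (ht : t ∈ A')
    (hmax : ∀ B : Subalgebra k R, A' < B → B ≤ T → B = T) {m : Ideal A'} (hm : m.IsMaximal)
    (htop : m.map (Subalgebra.inclusion h) = ⊤) (htm : (⟨t, ht⟩ : A') ∉ m) :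
    IsExtendingMaximalSubalgebra k (A'.powSaturation t ht) ∧ A'.powSaturation t ht ⊓ T = A' := by
  set A := A'.powSaturation t ht with hA
  have hA'A : A' ≤ A := A'.le_powSaturation t ht
  have hsA : s ∈ A := ⟨1, by rw [pow_one, mul_comm, hst]; exact A'.one_mem⟩
  have hTA : ¬ T ≤ A := by
    intro hTA
    refine htm (Ideal.mem_of_map_eq_top_of_pow_mul_mem_range
      (f := (Subalgebra.inclusion h).toRingHom) (Subalgebra.inclusion_injective h) hm.isPrime
      htop _ fun r => ?_)
    obtain ⟨n, hn⟩ := hTA r.2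
    exact ⟨n, ⟨_, hn⟩, Subtype.ext rfl⟩
  have hAT : A ⊓ T = A' := by
    by_contra hne
    have := hmax (A ⊓ T) ((le_inf hA'A h).lt_of_ne (Ne.symm hne)) inf_le_right
    exact hTA (inf_eq_right.1 this)
  refine ⟨⟨fun htopA => hTA (htopA ▸ le_top), fun B hB => ?_, ?_⟩, hAT⟩
  · have hA'B : A' ≤ B ⊓ T := le_inf (hA'A.trans hB.le) h
    rcases hA'B.lt_or_eq with hlt | heq
    · exact Subalgebra.eq_top_of_le_of_powSaturation_eq_top hst (hB.le hsA) htT hT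
        (inf_eq_right.1 (hmax _ hlt inf_le_right))
    · exfalso
      have := Subalgebra.powSaturation_inf_eq hst (hB.le hsA) (hB.le (hA'A ht)) htT hT
      simp only [← heq] at this
      exact hB.ne this
  · have hne : m.map (Subalgebra.inclusion hA'A) ≠ ⊤ := by
      intro htop'
      refine htm (Ideal.mem_of_map_eq_top_of_pow_mul_mem_range
        (f := (Subalgebra.inclusion hA'A).toRingHom) (Subalgebra.inclusion_injective hA'A)
        hm.isPrime htop' _ fun r => ?_)
      obtain ⟨n, hn⟩ := r.2
      exact ⟨n, ⟨_, hn⟩, Subtype.ext rfl⟩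
    obtain ⟨M, hM, hle⟩ := Ideal.exists_le_maximal _ hne
    refine ⟨M, hM, top_le_iff.1 (le_trans ?_ (Ideal.map_mono hle))⟩
    rw [Ideal.map_mapₐ]
    have : (A.val).comp (Subalgebra.inclusion hA'A) = T.val.comp (Subalgebra.inclusion h) := rfl
    rw [this, ← Ideal.map_mapₐ, htop, Ideal.map_top]

theorem isExtendingMaximalSubalgebraIn_inf {A T : Subalgebra k R} {t s u a b : R}
    (hst : s * t = 1) (htT : t ∈ T) (hT : T.powSaturation t htT = ⊤) (htA : t ∈ A) (hs : s ∈ A)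
    (hne : A ≠ ⊤) (hmax : ∀ B : Subalgebra k R, A < B → B = ⊤) {m : Ideal A}
    (hm : m.IsMaximal) (htop : m.map (A.val : A →ₐ[k] R) = ⊤)
    (huA : u ∈ A) (hum : (⟨u, huA⟩ : A) ∈ m) (huT : u ∈ T) (ha : a ∈ A ⊓ T) (hb : b ∈ A ⊓ T)
    (hab : a * t + b * u = 1) :
    IsExtendingMaximalSubalgebraIn k (A ⊓ T) T ∧
      ∃ n : Ideal ↥(A ⊓ T), n.IsMaximal ∧
        n.map (Subalgebra.inclusion (inf_le_right : A ⊓ T ≤ T)) = ⊤ ∧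
        (⟨t, htA, htT⟩ : ↥(A ⊓ T)) ∉ n := by
  have hTA : ¬ T ≤ A := fun h =>
    hne (Subalgebra.eq_top_of_le_of_powSaturation_eq_top hst hs htT hT h)
  have hsat := Subalgebra.powSaturation_inf_eq hst hs htA htT hT
  have hext : ∃ n : Ideal ↥(A ⊓ T), n.IsMaximal ∧
      n.map (Subalgebra.inclusion (inf_le_right : A ⊓ T ≤ T)) = ⊤ ∧
      (⟨t, htA, htT⟩ : ↥(A ⊓ T)) ∉ n := by
    let m' : Ideal ↥(A ⊓ T) := m.comap (Subalgebra.inclusion (inf_le_left : A ⊓ T ≤ A))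
    have hum' : (⟨u, huA, huT⟩ : ↥(A ⊓ T)) ∈ m' := hum
    have hm' : m' ≠ ⊤ := Ideal.comap_ne_top _ hm.ne_top
    set J := m'.map (Subalgebra.inclusion (inf_le_right : A ⊓ T ≤ T)) with hJ
    have hpow : ∃ n : ℕ, ∃ z ∈ J, (z : R) = t ^ n * 1 := by
      have h1 : (1 : R) ∈ m.map (A.val : A →ₐ[k] R) := by simp [htop]
      refine Ideal.map_induction (A.val : A →ₐ[k] R).toRingHom
        (P := fun x => ∃ n : ℕ, ∃ z ∈ J, (z : R) = t ^ n * x) ⟨0, 0, J.zero_mem, by simp⟩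
        ?_ ?_ h1
      · rintro x y ⟨n, z, hz, hx⟩ ⟨n', z', hz', hy⟩
        refine ⟨n + n', ⟨t, htT⟩ ^ n' * z + ⟨t, htT⟩ ^ n * z',
          J.add_mem (J.mul_mem_left _ hz) (J.mul_mem_left _ hz'), ?_⟩
        push_cast
        rw [hx, hy]
        ring
      · intro c hc r
        obtain ⟨n, hn⟩ : (c : R) ∈ T.powSaturation t htT := hT ▸ Algebra.mem_top
        obtain ⟨l, hl⟩ : r ∈ T.powSaturation t htT := hT ▸ Algebra.mem_top
        have hc' : (⟨t ^ n * c, A.mul_mem (A.pow_mem htA n) c.2, hn⟩ : ↥(A ⊓ T)) ∈ m' :=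
          m.mul_mem_left (⟨t, htA⟩ ^ n) hc
        refine ⟨l + n, ⟨t ^ l * r, hl⟩ * ⟨t ^ n * c, hn⟩,
          J.mul_mem_left _ (Ideal.mem_map_of_mem _ hc'), ?_⟩
        change t ^ l * r * (t ^ n * c) = t ^ (l + n) * (r * c)
        ring
    obtain ⟨n, z, hz, hzn⟩ := hpow
    have hJtop : J = ⊤ := by
      have hco : IsCoprime (⟨t, htT⟩ : T) ⟨u, huT⟩ :=
        ⟨⟨a, ha.2⟩, ⟨b, hb.2⟩, Subtype.ext hab⟩
      obtain ⟨a', b', h⟩ := hco.pow_left (m := n)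
      rw [Ideal.eq_top_iff_one, ← h]
      refine J.add_mem (J.mul_mem_left _ ?_) (J.mul_mem_left _ (Ideal.mem_map_of_mem _ hum'))
      have : z = ⟨t, htT⟩ ^ n := Subtype.ext (by simpa using hzn)
      exact this ▸ hz
    obtain ⟨M, hM, hle⟩ := Ideal.exists_le_maximal _ hm'
    refine ⟨M, hM, top_le_iff.1 (hJtop ▸ Ideal.map_mono hle), fun htM => hM.ne_top ?_⟩
    rw [Ideal.eq_top_iff_one]
    have : (1 : ↥(A ⊓ T)) = ⟨a, ha⟩ * ⟨t, htA, htT⟩ + ⟨b, hb⟩ * ⟨u, huA, huT⟩ :=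
      Subtype.ext hab.symm
    rw [this]
    exact M.add_mem (M.mul_mem_left _ htM) (M.mul_mem_left _ (hle hum'))
  refine ⟨⟨inf_le_right, fun h => hTA (inf_eq_right.1 h), fun B hB hBT => ?_, ?_⟩, hext⟩
  · have htB : t ∈ B := hB.le ⟨htA, htT⟩
    have hAB : A ≤ B.powSaturation t htB := by
      intro r hr
      rw [← hsat] at hr
      obtain ⟨n, hn⟩ := hr
      exact ⟨n, hB.le hn⟩
    have hBtop : B.powSaturation t htB = ⊤ := by
      rcases hAB.lt_or_eq with h | h
      · exact hmax _ h
      · exact absurd (le_inf (h ▸ B.le_powSaturation t htB) hBT) hB.not_ge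
    refine le_antisymm hBT fun f hf => ?_
    obtain ⟨n, hn⟩ : f ∈ B.powSaturation t htB := hBtop ▸ Algebra.mem_top
    obtain ⟨l, hl⟩ := Subalgebra.exists_pow_mul_mem_of_maximal hmax hm htop hum f
    exact Subalgebra.mem_of_isCoprime_pow_mul_mem htB (hB.le ⟨huA, huT⟩) (hB.le ha) (hB.le hb)
      hab hn (hB.le ⟨hl, T.mul_mem (T.pow_mem huT l) hf⟩)
  · obtain ⟨n, hn, hn', -⟩ := hext
    exact ⟨n, hn, hn'⟩

end General

section Laurent

open Polynomial

variable {k : Type*} [Field k]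

theorem Subalgebra.C_mem_of_T_mem {A : Subalgebra k (LaurentPolynomial k)[X]}
    (ht : C (LaurentPolynomial.T 1) ∈ A) (hs : C (LaurentPolynomial.T (-1)) ∈ A)
    (f : LaurentPolynomial k) : C f ∈ A := by
  induction f using LaurentPolynomial.induction_on' with
  | add p q hp hq => rw [C_add]; exact A.add_mem hp hq
  | C_mul_T n a =>
    rw [C_mul]
    refine A.mul_mem (A.algebraMap_mem a) ?_
    obtain ⟨n, rfl | rfl⟩ := n.eq_nat_or_neg
    · have := A.pow_mem ht n
      rwa [← C_pow, LaurentPolynomial.T_pow, mul_one] at this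
    · have := A.pow_mem hs n
      rwa [← C_pow, LaurentPolynomial.T_pow, mul_neg_one] at this

theorem Subalgebra.eq_top_of_T_mem_of_X_mem {A : Subalgebra k (LaurentPolynomial k)[X]}
    (ht : C (LaurentPolynomial.T 1) ∈ A) (hs : C (LaurentPolynomial.T (-1)) ∈ A)
    (hX : X ∈ A) : A = ⊤ := by
  refine top_le_iff.1 fun f _ => ?_
  induction f using Polynomial.induction_on' with
  | add p q hp hq => exact A.add_mem (hp trivial) (hq trivial)
  | monomial n a =>
    rw [← C_mul_X_pow_eq_monomial]
    exact A.mul_mem (C_mem_of_T_mem ht hs a) (A.pow_mem hX n)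

theorem Subalgebra.exists_natDegree_pos_of_maximal {A : Subalgebra k (LaurentPolynomial k)[X]}
    (hmax : ∀ B : Subalgebra k (LaurentPolynomial k)[X], A < B → B = ⊤) :
    ∃ f ∈ A, 0 < f.natDegree := by
  by_contra! h
  let B : Subalgebra k (LaurentPolynomial k)[X] :=
    { carrier := {f | f.coeff 1 = 0}
      mul_mem' := by
        intro f g hf hg
        simp only [Set.mem_ofPred_eq] at hf hg ⊢
        simp [mul_coeff_one, hf, hg]
      add_mem' := by
        intro f g hf hg
        simp only [Set.mem_ofPred_eq] at hf hg ⊢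
        simp [hf, hg]
      algebraMap_mem' := fun c => coeff_C_of_ne_zero one_ne_zero }
  have hlt : A < B := by
    refine lt_of_le_of_ne (fun f hf => ?_) fun heq => ?_
    · exact coeff_eq_zero_of_natDegree_lt ((h f hf).trans_lt one_pos)
    · have : (X ^ 2 : (LaurentPolynomial k)[X]) ∈ A := by
        rw [heq]
        change coeff _ 1 = 0
        simp [coeff_X_pow]
      simpa using h _ this
  have : (X : (LaurentPolynomial k)[X]) ∈ B := hmax B hlt ▸ Algebra.mem_top
  exact one_ne_zero (coeff_X_one.symm.trans this)

theorem isIntegral_C_leadingCoeff_mul_X {S A : Type*} [CommRing S] [CommRing A] [Algebra A S[X]]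
    (ι : S →+* A) (hι : (algebraMap A S[X]).comp ι = C) {f : S[X]} {a : A}
    (ha : algebraMap A S[X] a = f) (hdeg : 0 < f.natDegree) :
    IsIntegral A (C f.leadingCoeff * X) := by
  have hinj : Function.Injective ι := by
    refine Function.Injective.of_comp (f := algebraMap A S[X]) ?_
    rw [← RingHom.coe_comp, hι]
    exact C_injective
  have hdegp : (C a : A[X]).degree < (f.map ι).degree := by
    refine degree_C_le.trans_lt ?_
    rw [degree_map_eq_of_injective hinj]
    exact natDegree_pos_iff_degree_pos.1 hdeg
  have hroot : aeval (X : S[X]) (f.map ι - C a) = 0 := by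
    rw [map_sub, aeval_C, ha, aeval_def, eval₂_map, hι, eval₂_C_X, sub_self]
  have hint := isIntegral_leadingCoeff_smul (f.map ι - C a) _ hroot
  rwa [leadingCoeff_sub_of_degree_lt hdegp, leadingCoeff_map_of_injective hinj,
    Algebra.smul_def, ← RingHom.comp_apply, hι] at hint

theorem Subalgebra.exists_C_mem_crucial {A : Subalgebra k (LaurentPolynomial k)[X]}
    (hmax : ∀ B : Subalgebra k (LaurentPolynomial k)[X], A < B → B = ⊤) {m : Ideal A}
    (hm : m.IsMaximal) (htop : m.map (A.val : A →ₐ[k] (LaurentPolynomial k)[X]) = ⊤)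
    (hC : ∀ f : LaurentPolynomial k, C f ∈ A) :
    ∃ c : LaurentPolynomial k, c ≠ 0 ∧ (⟨C c, hC c⟩ : A) ∈ m := by
  obtain ⟨f, hf, hdeg⟩ := exists_natDegree_pos_of_maximal hmax
  let ι : LaurentPolynomial k →+* A := (C : _ →+* (LaurentPolynomial k)[X]).codRestrict A hC
  have hcX : C f.leadingCoeff * X ∈ A := mem_of_isIntegral_of_maximal hmax hm htop
    (isIntegral_C_leadingCoeff_mul_X ι (RingHom.ext fun _ => rfl) (a := ⟨f, hf⟩) rfl hdeg)
  refine ⟨f.leadingCoeff, leadingCoeff_ne_zero.2 (ne_zero_of_natDegree_gt hdeg),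
    mem_of_powSaturation_eq_top hm.isPrime htop _ ?_⟩
  exact eq_top_of_T_mem_of_X_mem (le_powSaturation _ _ _ (hC _)) (le_powSaturation _ _ _ (hC _))
    ⟨1, by rwa [pow_one]⟩

theorem Subalgebra.exists_coprime_T_mem_crucial {A : Subalgebra k (LaurentPolynomial k)[X]}
    (hmax : ∀ B : Subalgebra k (LaurentPolynomial k)[X], A < B → B = ⊤) {m : Ideal A}
    (hm : m.IsMaximal) (htop : m.map (A.val : A →ₐ[k] (LaurentPolynomial k)[X]) = ⊤)
    (hC : ∀ f : LaurentPolynomial k, C f ∈ A) :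
    ∃ q a b : k[X], a * X + b * q = 1 ∧ (⟨C (toLaurent q), hC _⟩ : A) ∈ m := by
  obtain ⟨c, hc0, hc⟩ := exists_C_mem_crucial hmax hm htop hC
  let ι : LaurentPolynomial k →+* A := (C : _ →+* (LaurentPolynomial k)[X]).codRestrict A hC
  obtain ⟨n, p, hp⟩ := LaurentPolynomial.exists_T_pow c
  have hp0 : p ≠ 0 := by
    rintro rfl
    rw [map_zero] at hp
    have := congrArg (· * LaurentPolynomial.T (-n : ℤ)) hp
    simp only [zero_mul, mul_assoc, ← LaurentPolynomial.T_add] at this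
    simp at this
    exact hc0 this.symm
  obtain ⟨q, hq, hqX⟩ := exists_eq_pow_rootMultiplicity_mul_and_not_dvd p hp0 0
  rw [C_0, sub_zero] at hq hqX
  set l := rootMultiplicity 0 p
  obtain ⟨a, b, hab⟩ := (irreducible_X.coprime_iff_not_dvd (n := q)).2 hqX
  refine ⟨q, a, b, hab, ?_⟩
  have hpm : ι (toLaurent p) ∈ m := by
    rw [hp, map_mul]
    exact m.mul_mem_right _ hc
  rw [hq, map_mul, map_pow, map_mul, map_pow, toLaurent_X] at hpm
  rcases hm.isPrime.mem_or_mem hpm with h | h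
  · exfalso
    have h' := hm.isPrime.mem_of_pow_mem _ h
    refine hm.ne_top ((Ideal.eq_top_iff_one _).2 ?_)
    have := m.mul_mem_left (ι (LaurentPolynomial.T (-1))) h'
    rw [← map_mul, ← LaurentPolynomial.T_add] at this
    simpa using this
  · exact h

theorem C_toLaurent_mem_adjoin (q : k[X]) : C (toLaurent q) ∈
    Algebra.adjoin k {(C (LaurentPolynomial.T 1) : (LaurentPolynomial k)[X])} := by
  induction q using Polynomial.induction_on' with
  | add p q hp hq => rw [map_add, C_add]; exact add_mem hp hq
  | monomial n a =>
    rw [← C_mul_X_pow_eq_monomial, map_mul, map_pow, toLaurent_X, toLaurent_C, C_mul, C_pow]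
    exact mul_mem (Subalgebra.algebraMap_mem _ a)
      (pow_mem (Algebra.subset_adjoin (Set.mem_singleton _)) n)

end Laurent

theorem bijection_containing_laurent_vs_crucial_avoiding_t
    {k : Type*} [Field k] [IsAlgClosed k] :
    Set.BijOn
      (fun A : Subalgebra k (Polynomial (LaurentPolynomial k)) =>
        A ⊓ Algebra.adjoin k
          {Polynomial.C (LaurentPolynomial.T 1), (Polynomial.X : Polynomial (LaurentPolynomial k))})
      -- extending maximal k-subalgebras of k[t,t⁻¹,y] containing k[t,t⁻¹]
      {A | IsExtendingMaximalSubalgebra k A ∧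
        Algebra.adjoin k
          {Polynomial.C (LaurentPolynomial.T 1), Polynomial.C (LaurentPolynomial.T (-1))} ≤ A}
      -- extending maximal k-subalgebras A' of k[t,y] containing k[t] whose crucial
      -- maximal ideal does not contain t: there is a maximal ideal 𝔪 of A' with
      -- 𝔪·k[t,y] = k[t,y] and t ∉ 𝔪
      {A' | ∃ h : A' ≤ Algebra.adjoin k
            {Polynomial.C (LaurentPolynomial.T 1), (Polynomial.X : Polynomial (LaurentPolynomial k))},
        IsExtendingMaximalSubalgebraIn k A'
          (Algebra.adjoin k
            {Polynomial.C (LaurentPolynomial.T 1), (Polynomial.X : Polynomial (LaurentPolynomial k))}) ∧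
        Algebra.adjoin k {(Polynomial.C (LaurentPolynomial.T 1) : Polynomial (LaurentPolynomial k))} ≤ A' ∧
        ∃ m : Ideal ↥A', m.IsMaximal ∧ Ideal.map (Subalgebra.inclusion h) m = ⊤ ∧
          ∀ x : ↥A', (x : Polynomial (LaurentPolynomial k)) = Polynomial.C (LaurentPolynomial.T 1) →
            x ∉ m} := by
  set t : Polynomial (LaurentPolynomial k) := Polynomial.C (LaurentPolynomial.T 1) with ht
  set s : Polynomial (LaurentPolynomial k) := Polynomial.C (LaurentPolynomial.T (-1)) with hs
  set T := Algebra.adjoin k {t, (Polynomial.X : Polynomial (LaurentPolynomial k))}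
  have hst : s * t = 1 := by
    rw [hs, ht, ← Polynomial.C_mul, ← LaurentPolynomial.T_add]
    simp
  have htT : t ∈ T := Algebra.subset_adjoin (by simp)
  have hXT : Polynomial.X ∈ T := Algebra.subset_adjoin (by simp)
  have hT : T.powSaturation t htT = ⊤ :=
    Subalgebra.eq_top_of_T_mem_of_X_mem (T.le_powSaturation t htT htT)
      ⟨1, by rw [pow_one, mul_comm, hst]; exact T.one_mem⟩ (T.le_powSaturation t htT hXT)
  have htL : ∀ {A : Subalgebra k (Polynomial (LaurentPolynomial k))},
      Algebra.adjoin k {t, s} ≤ A → t ∈ A ∧ s ∈ A := fun h =>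
    ⟨h (Algebra.subset_adjoin (by simp)), h (Algebra.subset_adjoin (by simp))⟩
  refine ⟨?_, ?_, ?_⟩
  · rintro A ⟨⟨hne, hmax, m, hm, htop⟩, hL⟩
    obtain ⟨htA, hsA⟩ := htL hL
    obtain ⟨q, a, b, hab, hq⟩ := Subalgebra.exists_coprime_T_mem_crucial hmax hm htop
      (Subalgebra.C_mem_of_T_mem htA hsA)
    have hmem : ∀ p : Polynomial k, Polynomial.C p.toLaurent ∈ A ⊓ T := fun p =>
      Algebra.adjoin_le (Set.singleton_subset_iff.2 (⟨htA, htT⟩ : t ∈ A ⊓ T))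
        (C_toLaurent_mem_adjoin p)
    have hab' : Polynomial.C a.toLaurent * t + Polynomial.C b.toLaurent *
        Polynomial.C q.toLaurent = 1 := by
      have := congrArg (fun p : Polynomial k => Polynomial.C p.toLaurent) hab
      simpa only [map_add, map_mul, map_one, Polynomial.toLaurent_X] using this
    obtain ⟨h1, n, hn, hn', htn⟩ := isExtendingMaximalSubalgebraIn_inf hst htT hT htA hsA hne
      hmax hm htop (hmem q).1 hq (hmem q).2 (hmem a) (hmem b) hab'
    refine ⟨inf_le_right, h1,
      Algebra.adjoin_le (Set.singleton_subset_iff.2 (⟨htA, htT⟩ : t ∈ A ⊓ T)),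
      n, hn, hn', fun x hx hxn => htn ?_⟩
    have : x = ⟨t, htA, htT⟩ := Subtype.ext hx
    exact this ▸ hxn
  · rintro A ⟨-, hL⟩ B ⟨-, hL'⟩ (hAB : A ⊓ T = B ⊓ T)
    obtain ⟨htA, hsA⟩ := htL hL
    obtain ⟨htB, hsB⟩ := htL hL'
    rw [← Subalgebra.powSaturation_inf_eq hst hsA htA htT hT,
      ← Subalgebra.powSaturation_inf_eq hst hsB htB htT hT]
    simp only [hAB]
  · rintro A' ⟨h, ⟨_, _, hmax, _⟩, hk, m, hm, htop, htm⟩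
    have htA' : t ∈ A' := hk (Algebra.subset_adjoin (Set.mem_singleton _))
    obtain ⟨h1, h2⟩ := isExtendingMaximalSubalgebra_powSaturation hst htT hT h htA' hmax hm htop
      (htm _ rfl)
    refine ⟨A'.powSaturation t htA', ⟨h1, Algebra.adjoin_le ?_⟩, h2⟩
    rintro x (rfl | rfl)
    · exact A'.le_powSaturation t htA' htA'
    · exact ⟨1, by rw [pow_one, mul_comm, hst]; exact A'.one_mem⟩
end

section
/- Let k be an algebraically closed field and let k[t, y, y^{−1}] be the Laurent polynomial ring in y over the polynomial ring k[t]; inside it, let k[t, y] be the subalgebra of Laurent polynomials with no negative powers of y, k[t, y^{−1}] the subalgebra with no positive powers of y, and k[t] the coefficient ring. Let ℳ be the set of extending maximal k-subalgebras of k[t, y] that contain k[t]. Let 𝒩 be the set of extending maximal k-subalgebras A of k[t, y, y^{−1}] that contain k[t, y^{−1}] and such that for every λ ∈ k and every maximal ideal 𝔪 of A with 𝔪·k[t, y, y^{−1}] = k[t, y, y^{−1}] and t − λ ∈ 𝔪, the composite ring homomorphism A → k[t, y, y^{−1}] → k[t, y, y^{−1}]/(t − λ) is surjective. Then the map Θ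 : 𝒩 → ℳ given by Θ(A) = A ∩ k[t, y] is well-defined and bijective. -/
namespace LaurentSubalgebra

open Polynomial LaurentPolynomial

/-- The subalgebra `k[t, y]` of `k[t, y, y⁻¹]`. -/
noncomputable abbrev pos (k : Type*) [Field k] : Subalgebra k (LaurentPolynomial k[X]) :=
  Algebra.adjoin k {LaurentPolynomial.C (X : k[X]), LaurentPolynomial.T 1}

/-- The subalgebra `k[t, y⁻¹]` of `k[t, y, y⁻¹]`. -/
noncomputable abbrev neg (k : Type*) [Field k] : Subalgebra k (LaurentPolynomial k[X]) :=
  Algebra.adjoin k {LaurentPolynomial.C (X : k[X]), LaurentPolynomial.T (-1)}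

variable {k : Type*} [Field k]

theorem T_one_mul_T_neg_one :
    (T 1 * T (-1) : LaurentPolynomial k[X]) = 1 := by
  rw [← T_add]; simp

theorem C_mem {B : Subalgebra k (LaurentPolynomial k[X])}
    (h : LaurentPolynomial.C (X : k[X]) ∈ B) (a : k[X]) : LaurentPolynomial.C a ∈ B := by
  have hle : Algebra.adjoin k {LaurentPolynomial.C (X : k[X])} ≤ B :=
    Algebra.adjoin_le (by simpa using h)
  have : aeval (LaurentPolynomial.C (X : k[X])) a = LaurentPolynomial.C a := by
    induction a using Polynomial.induction_on' with
    | add p q hp hq => simp [hp, hq]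
    | monomial n c =>
      rw [aeval_monomial, ← C_mul_X_pow_eq_monomial, map_mul, map_pow]
      rfl
  rw [← this]
  exact hle (aeval_mem_adjoin_singleton k _)

theorem C_mem_pos (a : k[X]) : LaurentPolynomial.C a ∈ pos k :=
  C_mem (Algebra.subset_adjoin (by simp)) a

theorem C_mem_neg (a : k[X]) : LaurentPolynomial.C a ∈ neg k :=
  C_mem (Algebra.subset_adjoin (by simp)) a

theorem T_mem_pos : (T 1 : LaurentPolynomial k[X]) ∈ pos k :=
  Algebra.subset_adjoin (by simp)

theorem T_mem_neg : (T (-1) : LaurentPolynomial k[X]) ∈ neg k :=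
  Algebra.subset_adjoin (by simp)

theorem mem_pos_iff {x : LaurentPolynomial k[X]} :
    x ∈ pos k ↔ ∃ q : k[X][X], toLaurent q = x := by
  constructor
  · intro hx
    have : pos k ≤ ((toLaurentAlg (R := k[X])).restrictScalars k).range := by
      refine Algebra.adjoin_le ?_
      rintro z (rfl | rfl)
      · exact ⟨Polynomial.C X, by simp⟩
      · exact ⟨X, by simp⟩
    obtain ⟨q, hq⟩ := this hx
    exact ⟨q, by simpa using hq⟩
  · rintro ⟨q, rfl⟩
    induction q using Polynomial.induction_on' with
    | add p q hp hq => rw [map_add]; exact add_mem hp hq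
    | monomial n c =>
      rw [toLaurent_C_mul_T]
      refine mul_mem (C_mem_pos c) ?_
      have := pow_mem (T_mem_pos (k := k)) n
      rwa [T_pow, mul_one] at this

theorem exists_invert_toLaurent {x : LaurentPolynomial k[X]} (hx : x ∈ neg k) :
    ∃ q : k[X][X], invert (toLaurent q) = x := by
  have : neg k ≤ ((invert (R := k[X])).toAlgHom.comp
      (toLaurentAlg (R := k[X])) |>.restrictScalars k).range := by
    refine Algebra.adjoin_le ?_
    rintro z (rfl | rfl)
    · exact ⟨Polynomial.C X, by simp⟩
    · exact ⟨X, by simp⟩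
  obtain ⟨q, hq⟩ := this hx
  exact ⟨q, by simpa using hq⟩

theorem T_neg_natCast_mem_neg (n : ℕ) : (T (-n) : LaurentPolynomial k[X]) ∈ neg k := by
  have := pow_mem (T_mem_neg (k := k)) n
  rwa [T_pow, mul_neg_one] at this

theorem trunc_invert_toLaurent (q : k[X][X]) :
    trunc (invert (toLaurent q)) = Polynomial.C (q.coeff 0) := by
  induction q using Polynomial.induction_on' with
  | add f g hf hg => simp [hf, hg]
  | monomial n c =>
    rw [toLaurent_C_mul_T, map_mul, invert_C, invert_T, trunc_C_mul_T]
    rcases n with _ | n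
    · simp
    · rw [if_neg (by push_cast; omega)]
      simp [coeff_monomial]

theorem exists_eq_C {x : LaurentPolynomial k[X]} (hx : x ∈ pos k) (hx' : x ∈ neg k) :
    ∃ a : k[X], x = LaurentPolynomial.C a := by
  obtain ⟨p, rfl⟩ := mem_pos_iff.1 hx
  obtain ⟨q, hq⟩ := exists_invert_toLaurent hx'
  refine ⟨q.coeff 0, ?_⟩
  rw [← toLaurent_C, ← trunc_toLaurent p, ← hq, trunc_invert_toLaurent]

theorem exists_add (r : LaurentPolynomial k[X]) : ∃ s ∈ pos k, ∃ s' ∈ neg k, r = s + s' := by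
  induction r using LaurentPolynomial.induction_on' with
  | add p q hp hq =>
    obtain ⟨s, hs, s', hs', rfl⟩ := hp
    obtain ⟨u, hu, u', hu', rfl⟩ := hq
    exact ⟨s + u, add_mem hs hu, s' + u', add_mem hs' hu', by ring⟩
  | C_mul_T n a =>
    obtain ⟨m, rfl | rfl⟩ := n.eq_nat_or_neg
    · exact ⟨_, mem_pos_iff.2 ⟨monomial m a, rfl⟩, 0, zero_mem _, by simp [toLaurent_C_mul_T]⟩
    · exact ⟨0, zero_mem _, _, mul_mem (C_mem_neg a) (T_neg_natCast_mem_neg m), by simp⟩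

theorem exists_pow_mul_mem_neg (r : LaurentPolynomial k[X]) :
    ∃ n : ℕ, T (-1) ^ n * r ∈ neg k := by
  induction r using LaurentPolynomial.induction_on' with
  | add p q hp hq =>
    obtain ⟨n, hn⟩ := hp
    obtain ⟨m, hm⟩ := hq
    refine ⟨n + m, ?_⟩
    have e : (T (-1) ^ (n + m) * (p + q) : LaurentPolynomial k[X]) =
        T (-1) ^ m * (T (-1) ^ n * p) + T (-1) ^ n * (T (-1) ^ m * q) := by ring
    rw [e]
    exact add_mem (mul_mem (pow_mem T_mem_neg _) hn) (mul_mem (pow_mem T_mem_neg _) hm)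
  | C_mul_T n a =>
    obtain ⟨m, rfl | rfl⟩ := n.eq_nat_or_neg
    · refine ⟨m, ?_⟩
      rw [mul_left_comm, T_pow, ← T_add, mul_neg_one, neg_add_cancel, T_zero, mul_one]
      exact C_mem_neg a
    · exact ⟨0, by simpa using mul_mem (C_mem_neg a) (T_neg_natCast_mem_neg m)⟩

theorem eq_top_of_T_mem {A : Subalgebra k (LaurentPolynomial k[X])} (hA : neg k ≤ A)
    (hT : T 1 ∈ A) : A = ⊤ := by
  have hpos : pos k ≤ A := Algebra.adjoin_le <| by
    rintro z (rfl | rfl)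
    exacts [hA (C_mem_neg X), hT]
  refine eq_top_iff.2 fun r _ => ?_
  obtain ⟨s, hs, s', hs', rfl⟩ := exists_add r
  exact add_mem (hpos hs) (hA hs')

/-- A subalgebra of `k[t, y]` containing `k[t]` and stable under `b ↦ (b - b(0)) / y`
contains `c y` for every leading coefficient `c` of an element of positive degree in `y`. -/
theorem leadingCoeff_mul_T_mem {B : Subalgebra k (LaurentPolynomial k[X])}
    (hC : ∀ a : k[X], LaurentPolynomial.C a ∈ B)
    (hB : ∀ q : k[X][X], T 1 * toLaurent q ∈ B → toLaurent q ∈ B)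
    (q : k[X][X]) (hq : toLaurent q ∈ B) (hd : q.natDegree ≠ 0) :
    LaurentPolynomial.C q.leadingCoeff * T 1 ∈ B := by
  obtain ⟨n, hn⟩ := Nat.exists_eq_succ_of_ne_zero hd
  induction n generalizing q with
  | zero =>
    have h : toLaurent q - LaurentPolynomial.C (q.coeff 0) ∈ B := sub_mem hq (hC _)
    have e := q.as_sum_range_C_mul_X_pow
    rw [hn] at e
    have e' : toLaurent q = LaurentPolynomial.C (q.coeff 0) +
        LaurentPolynomial.C q.leadingCoeff * T 1 := by
      conv_lhs => rw [e]
      simp [Finset.sum_range_succ, leadingCoeff, hn]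
    rwa [e', add_sub_cancel_left] at h
  | succ n ih =>
    have hdiv : q.divX.natDegree = n + 1 := by
      rw [natDegree_divX_eq_natDegree_tsub_one, hn]; rfl
    have hlc : q.divX.leadingCoeff = q.leadingCoeff := by
      rw [leadingCoeff, hdiv, coeff_divX, leadingCoeff, hn]
    rw [← hlc]
    refine ih _ (hB _ ?_) (by omega) hdiv
    have e : T 1 * toLaurent q.divX = toLaurent q - LaurentPolynomial.C (q.coeff 0) := by
      rw [eq_sub_iff_add_eq, ← toLaurent_X, ← toLaurent_C, ← map_mul, ← map_add, X_mul_divX_add]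
    rw [e]
    exact sub_mem hq (hC _)

/-- Translates of a subalgebra `A` by the ideals `(t - λ)` fill the whole ring. -/
def IsTransversal (A : Subalgebra k (LaurentPolynomial k[X])) : Prop :=
  ∀ (lam : k) (r : LaurentPolynomial k[X]), ∃ a ∈ A, ∃ s,
    r = a + LaurentPolynomial.C (X - Polynomial.C lam) * s

theorem IsTransversal.exists_eq_add [IsAlgClosed k] {A : Subalgebra k (LaurentPolynomial k[X])}
    (hA : neg k ≤ A) (h : IsTransversal A) {f : k[X]} (hf : f ≠ 0) (r : LaurentPolynomial k[X]) :
    ∃ a ∈ A, ∃ s, r = a + LaurentPolynomial.C f * s := by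
  induction hn : f.natDegree generalizing f r with
  | zero =>
    obtain ⟨c, rfl⟩ := natDegree_eq_zero.1 hn
    have hc : c ≠ 0 := by simpa using hf
    refine ⟨0, zero_mem _, LaurentPolynomial.C (Polynomial.C c⁻¹) * r, ?_⟩
    rw [zero_add, ← mul_assoc, ← map_mul, ← map_mul, mul_inv_cancel₀ hc]
    simp
  | succ n ih =>
    obtain ⟨x, hx⟩ := IsAlgClosed.exists_root f
      (by rw [degree_eq_natDegree hf, hn]; exact_mod_cast n.succ_ne_zero)
    obtain ⟨g, rfl⟩ := dvd_iff_isRoot.2 hx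
    have hg : g ≠ 0 := right_ne_zero_of_mul hf
    obtain ⟨a, ha, s, rfl⟩ := h x r
    obtain ⟨b, hb, u, rfl⟩ := ih hg s (by
      rw [natDegree_mul (X_sub_C_ne_zero x) hg, natDegree_X_sub_C] at hn; omega)
    refine ⟨a + LaurentPolynomial.C (X - Polynomial.C x) * b,
      add_mem ha (mul_mem (hA (C_mem_neg _)) hb), u, ?_⟩
    rw [map_mul]; ring


section Restriction

variable {A : Subalgebra k (LaurentPolynomial k[X])}

theorem mem_of_T_mul_mem (hA : neg k ≤ A) {x : LaurentPolynomial k[X]} (hx : T 1 * x ∈ A) :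
    x ∈ A := by
  have e : x = T (-1) * (T 1 * x) := by rw [← mul_assoc, ← T_add]; simp
  rw [e]
  exact mul_mem (hA T_mem_neg) hx

theorem exists_add_of_mem (hA : neg k ≤ A) {x : LaurentPolynomial k[X]} (hx : x ∈ A) :
    ∃ b ∈ A ⊓ pos k, ∃ s ∈ neg k, x = b + s := by
  obtain ⟨b, hb, s, hs, rfl⟩ := exists_add x
  exact ⟨b, ⟨by simpa using sub_mem hx (hA hs), hb⟩, s, hs, rfl⟩

theorem exists_T_eq_add (hA : neg k ≤ A) {f : k[X]}
    (h : ∃ a ∈ A, ∃ s, (T 1 : LaurentPolynomial k[X]) = a + LaurentPolynomial.C f * s) :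
    ∃ a ∈ A, ∃ q : k[X][X],
      (T 1 : LaurentPolynomial k[X]) = a + LaurentPolynomial.C f * toLaurent q := by
  obtain ⟨a, ha, s, hs⟩ := h
  obtain ⟨u, hu, v, hv, rfl⟩ := exists_add s
  obtain ⟨q, rfl⟩ := mem_pos_iff.1 hu
  exact ⟨a + LaurentPolynomial.C f * v, add_mem ha (hA (mul_mem (C_mem_neg f) hv)), q, by
    rw [hs]; ring⟩

theorem exists_C_mul_T_mem (hA : neg k ≤ A) (h : IsTransversal A) :
    ∃ c : k[X], c ≠ 0 ∧ LaurentPolynomial.C c * T 1 ∈ A := by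
  obtain ⟨a, ha, q, hq⟩ := exists_T_eq_add hA (h 0 (T 1))
  set p : k[X][X] := X - Polynomial.C (X - Polynomial.C 0) * q with hp
  have hpa : toLaurent p = a := by
    rw [hp, map_sub, map_mul, toLaurent_X, toLaurent_C, hq]; ring
  have h1 : p.coeff 1 ≠ 0 := by
    intro h0
    have := congrArg (Polynomial.eval 0) h0
    simp [hp] at this
  have hd : p.natDegree ≠ 0 := by
    have := le_natDegree_of_ne_zero h1
    omega
  refine ⟨p.leadingCoeff, leadingCoeff_ne_zero.2 ?_, leadingCoeff_mul_T_mem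
    (fun a => hA (C_mem_neg a)) (fun _ => mem_of_T_mul_mem hA) p (hpa ▸ ha) hd⟩
  rintro h0
  simp [h0] at h1

theorem exists_one_add_T_mul [IsAlgClosed k] (hA : neg k ≤ A) (h : IsTransversal A) :
    ∃ q ∈ A ⊓ pos k, T 1 * (1 + T 1 * q) ∈ A ∧ 1 + T 1 * q ∈ A ⊓ pos k := by
  obtain ⟨c, hc, hcA⟩ := exists_C_mul_T_mem hA h
  obtain ⟨a, ha, ρ, hρ⟩ := exists_T_eq_add hA (h.exists_eq_add hA hc (T 1))
  set q : LaurentPolynomial k[X] := -LaurentPolynomial.C c * toLaurent ρ.divX.divX with hq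
  have hqpos : q ∈ pos k :=
    mul_mem (neg_mem (C_mem_pos c)) (mem_pos_iff.2 ⟨_, rfl⟩)
  have e : toLaurent ρ = T 1 * (T 1 * toLaurent ρ.divX.divX +
      LaurentPolynomial.C (ρ.divX.coeff 0)) + LaurentPolynomial.C (ρ.coeff 0) := by
    rw [← toLaurent_X, ← toLaurent_C, ← toLaurent_C]
    simp only [← map_mul, ← map_add, X_mul_divX_add]
  have hw : T 1 * (1 + T 1 * q) ∈ A := by
    have : T 1 * (1 + T 1 * q) = a + LaurentPolynomial.C c * LaurentPolynomial.C (ρ.coeff 0) +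
        LaurentPolynomial.C (ρ.divX.coeff 0) * (LaurentPolynomial.C c * T 1) := by
      rw [hq]
      linear_combination hρ + LaurentPolynomial.C c * e
    rw [this]
    exact add_mem (add_mem ha (hA (mul_mem (C_mem_neg _) (C_mem_neg _))))
      (mul_mem (hA (C_mem_neg _)) hcA)
  have hw' := mem_of_T_mul_mem hA hw
  refine ⟨q, ⟨mem_of_T_mul_mem hA ?_, hqpos⟩, hw, hw',
    add_mem (one_mem _) (mul_mem T_mem_pos hqpos)⟩
  simpa using sub_mem hw' (one_mem A)

theorem exists_T_neg_one_eq_add [IsAlgClosed k] (hA : neg k ≤ A) (h : IsTransversal A) (n : ℕ) :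
    ∃ b ∈ A ⊓ pos k, ∃ a ∈ A, (T (-1) : LaurentPolynomial k[X]) = b + T (-1) ^ n * a := by
  obtain ⟨q, hq, hw, hw'⟩ := exists_one_add_T_mul hA h
  induction n with
  | zero => exact ⟨0, zero_mem _, _, hA T_mem_neg, by simp⟩
  | succ n ih =>
    obtain ⟨b, hb, a, ha, hab⟩ := ih
    refine ⟨-q + (1 + T 1 * q) * b, add_mem (neg_mem hq) (mul_mem hw' hb),
      T 1 * (1 + T 1 * q) * a, mul_mem hw ha, ?_⟩
    have e := T_one_mul_T_neg_one (k := k)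
    linear_combination (1 + T 1 * q) * hab -
      (q + T (-1) ^ n * (1 + T 1 * q) * a) * e

theorem exists_eq_add_pow_mul [IsAlgClosed k] (hA : neg k ≤ A) (h : IsTransversal A) (n : ℕ)
    {x : LaurentPolynomial k[X]} (hx : x ∈ A) :
    ∃ b ∈ A ⊓ pos k, ∃ a ∈ A, x = b + T (-1) ^ n * a := by
  obtain ⟨b, hb, s, hs, rfl⟩ := exists_add_of_mem hA hx
  suffices hs' : ∃ b ∈ A ⊓ pos k, ∃ a ∈ A, s = b + T (-1) ^ n * a by
    obtain ⟨b', hb', a, ha, rfl⟩ := hs'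
    exact ⟨b + b', add_mem hb hb', a, ha, by ring⟩
  clear hx hb
  induction hs using Algebra.adjoin_induction with
  | mem x hx =>
    rcases hx with rfl | rfl
    · exact ⟨_, ⟨hA (C_mem_neg X), C_mem_pos X⟩, 0, zero_mem _, by simp⟩
    · exact exists_T_neg_one_eq_add hA h n
  | algebraMap r => exact ⟨_, Subalgebra.algebraMap_mem _ r, 0, zero_mem _, by simp⟩
  | add x y _ _ hx hy =>
    obtain ⟨b, hb, a, ha, rfl⟩ := hx
    obtain ⟨c, hc, d, hd, rfl⟩ := hy
    exact ⟨b + c, add_mem hb hc, a + d, add_mem ha hd, by ring⟩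
  | mul x y _ _ hx hy =>
    obtain ⟨b, hb, a, ha, rfl⟩ := hx
    obtain ⟨c, hc, d, hd, rfl⟩ := hy
    refine ⟨b * c, mul_mem hb hc, b * d + c * a + T (-1) ^ n * a * d, ?_, by ring⟩
    exact add_mem (add_mem (mul_mem hb.1 hd) (mul_mem hc.1 ha))
      (mul_mem (mul_mem (pow_mem (hA T_mem_neg) _) ha) hd)

theorem exists_mul_eq_add [IsAlgClosed k] (hA : neg k ≤ A) (h : IsTransversal A)
    {B : Subalgebra k (LaurentPolynomial k[X])} (hB : A ⊓ pos k ≤ B)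
    {a b : LaurentPolynomial k[X]} (ha : a ∈ A) (hb : b ∈ B) :
    ∃ c ∈ A, ∃ d ∈ B, a * b = c + d := by
  obtain ⟨n, hn⟩ := exists_pow_mul_mem_neg b
  obtain ⟨e, he, f, hf, rfl⟩ := exists_eq_add_pow_mul hA h n ha
  exact ⟨f * (T (-1) ^ n * b), mul_mem hf (hA hn), e * b, mul_mem (hB he) hb, by ring⟩

/-- The sum of `A` and a subalgebra containing `A ∩ k[t, y]`. -/
noncomputable def sum [IsAlgClosed k] (hA : neg k ≤ A) (h : IsTransversal A)
    (B : Subalgebra k (LaurentPolynomial k[X])) (hB : A ⊓ pos k ≤ B) :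
    Subalgebra k (LaurentPolynomial k[X]) where
  carrier := {x | ∃ a ∈ A, ∃ b ∈ B, x = a + b}
  algebraMap_mem' r := ⟨_, A.algebraMap_mem r, 0, zero_mem _, by simp⟩
  add_mem' := by
    rintro _ _ ⟨a, ha, b, hb, rfl⟩ ⟨c, hc, d, hd, rfl⟩
    exact ⟨a + c, add_mem ha hc, b + d, add_mem hb hd, by ring⟩
  mul_mem' := by
    rintro _ _ ⟨a, ha, b, hb, rfl⟩ ⟨c, hc, d, hd, rfl⟩
    obtain ⟨e, he, f, hf, h1⟩ := exists_mul_eq_add hA h hB ha hd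
    obtain ⟨u, hu, v, hv, h2⟩ := exists_mul_eq_add hA h hB hc hb
    refine ⟨a * c + e + u, add_mem (add_mem (mul_mem ha hc) he) hu, f + v + b * d,
      add_mem (add_mem hf hv) (mul_mem hb hd), ?_⟩
    linear_combination h1 + h2

theorem eq_pos_of_inf_lt [IsAlgClosed k] (hA : neg k ≤ A) (h : IsTransversal A)
    (hmax : ∀ B : Subalgebra k (LaurentPolynomial k[X]), A < B → B = ⊤)
    {B : Subalgebra k (LaurentPolynomial k[X])} (hB : A ⊓ pos k < B) (hBp : B ≤ pos k) :
    B = pos k := by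
  have hlt : A < sum hA h B hB.le := by
    obtain ⟨b, hb, hbA⟩ := SetLike.exists_of_lt hB
    refine SetLike.lt_iff_le_and_exists.2 ⟨fun a ha => ⟨a, ha, 0, zero_mem _, by simp⟩,
      b, show ∃ a ∈ A, ∃ c ∈ B, b = a + c from ⟨0, zero_mem _, b, hb, by simp⟩, fun hA' => hbA ⟨hA', hBp hb⟩⟩
  refine le_antisymm hBp fun s hs => ?_
  obtain ⟨a, ha, b, hb, rfl⟩ : s ∈ sum hA h B hB.le := by rw [hmax _ hlt]; trivial
  refine add_mem (hB.le ⟨ha, ?_⟩) hb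
  simpa using sub_mem hs (hBp hb)

theorem isExtendingMaximalSubalgebraIn_inf [IsAlgClosed k] (hA : neg k ≤ A)
    (h : IsTransversal A) (hne : A ≠ ⊤)
    (hmax : ∀ B : Subalgebra k (LaurentPolynomial k[X]), A < B → B = ⊤) :
    IsExtendingMaximalSubalgebraIn k (A ⊓ pos k) (pos k) := by
  have hT : T 1 ∉ A := fun hT => hne (eq_top_of_T_mem hA hT)
  refine ⟨inf_le_right, fun he => hT ?_, fun B hB hBp => eq_pos_of_inf_lt hA h hmax hB hBp, ?_⟩
  · exact inf_eq_right.1 he T_mem_pos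
  obtain ⟨q, hq, hw, hw'⟩ := exists_one_add_T_mul hA h
  let I : Ideal ↥(A ⊓ pos k) :=
    { carrier := {b | T 1 * (b : LaurentPolynomial k[X]) ∈ A}
      zero_mem' := by simp
      add_mem' := fun {a b} ha hb => by
        have := add_mem (show T 1 * (a : LaurentPolynomial k[X]) ∈ A from ha)
          (show T 1 * (b : LaurentPolynomial k[X]) ∈ A from hb)
        rwa [← mul_add] at this
      smul_mem' := fun c b hb => by
        have := mul_mem c.2.1 (show T 1 * (b : LaurentPolynomial k[X]) ∈ A from hb)
        rwa [mul_left_comm] at this }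
  have hI : I ≠ ⊤ := by
    rw [Ideal.ne_top_iff_one]
    intro h1
    exact hT (by simpa using (show T 1 * ((1 : ↥(A ⊓ pos k)) : LaurentPolynomial k[X]) ∈ A from h1))
  obtain ⟨m, hm, hIm⟩ := I.exists_le_maximal hI
  refine ⟨m, hm, (Ideal.eq_top_iff_one _).2 ?_⟩
  have hqI : (⟨q, hq⟩ : ↥(A ⊓ pos k)) ∈ m := by
    refine hIm (show T 1 * q ∈ A from ?_)
    simpa using sub_mem hw'.1 (one_mem A)
  have hwI : (⟨_, hw'⟩ : ↥(A ⊓ pos k)) ∈ m := hIm hw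
  have key := Ideal.sub_mem _ (Ideal.mem_map_of_mem (Subalgebra.inclusion inf_le_right) hwI)
    (Ideal.mul_mem_left _ (⟨T 1, T_mem_pos⟩ : ↥(pos k))
      (Ideal.mem_map_of_mem (Subalgebra.inclusion inf_le_right) hqI))
  convert key
  apply Subtype.ext
  simp

end Restriction

section Transversal

variable {A : Subalgebra k (LaurentPolynomial k[X])}

/-- The subalgebra `A + f S` of a subalgebra `S` containing `A` and `f`. -/
noncomputable def addMul {R : Type*} [CommRing R] [Algebra k R] {A S : Subalgebra k R}
    (hAS : A ≤ S) {f : R} (hf : f ∈ S) : Subalgebra k R where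
  carrier := {x | ∃ a ∈ A, ∃ s ∈ S, x = a + f * s}
  algebraMap_mem' r := ⟨_, A.algebraMap_mem r, 0, zero_mem _, by simp⟩
  add_mem' := by
    rintro _ _ ⟨a, ha, s, hs, rfl⟩ ⟨b, hb, u, hu, rfl⟩
    exact ⟨a + b, add_mem ha hb, s + u, add_mem hs hu, by ring⟩
  mul_mem' := by
    rintro _ _ ⟨a, ha, s, hs, rfl⟩ ⟨b, hb, u, hu, rfl⟩
    exact ⟨a * b, mul_mem ha hb, a * u + b * s + f * s * u,
      add_mem (add_mem (mul_mem (hAS ha) hu) (mul_mem (hAS hb) hs))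
        (mul_mem (mul_mem hf hs) hu), by ring⟩

theorem le_addMul {R : Type*} [CommRing R] [Algebra k R] {A S : Subalgebra k R}
    (hAS : A ≤ S) {f : R} (hf : f ∈ S) : A ≤ addMul hAS hf :=
  fun a ha => ⟨a, ha, 0, zero_mem _, by simp⟩

theorem C_X_sub_C (lam : k) : LaurentPolynomial.C (X - Polynomial.C lam) =
    LaurentPolynomial.C (X : k[X]) - algebraMap k (LaurentPolynomial k[X]) lam := by
  rw [map_sub]; rfl

theorem map_val_eq_top (hA : neg k ≤ A) {m : Ideal ↥A} (hm : ⟨T (-1), hA T_mem_neg⟩ ∈ m) :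
    Ideal.map (A.val : ↥A →ₐ[k] LaurentPolynomial k[X]) m = ⊤ :=
  Ideal.eq_top_of_isUnit_mem _ (Ideal.mem_map_of_mem A.val hm) (isUnit_T (-1))

theorem exists_isMaximal_map_val_eq_top (hA : neg k ≤ A) (hne : A ≠ ⊤) :
    ∃ m : Ideal ↥A, m.IsMaximal ∧
      Ideal.map (A.val : ↥A →ₐ[k] LaurentPolynomial k[X]) m = ⊤ := by
  have hspan : Ideal.span {(⟨T (-1), hA T_mem_neg⟩ : ↥A)} ≠ ⊤ := by
    rw [Ne, Ideal.eq_top_iff_one, Ideal.mem_span_singleton]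
    rintro ⟨⟨a, haA⟩, ha⟩
    refine hne (eq_top_of_T_mem hA ?_)
    have ha' : (1 : LaurentPolynomial k[X]) = T (-1) * a := congrArg Subtype.val ha
    have e : T 1 = a := by
      linear_combination T 1 * ha' + a * T_one_mul_T_neg_one (k := k)
    rwa [e]
  obtain ⟨m, hm, hle⟩ := Ideal.exists_le_maximal _ hspan
  exact ⟨m, hm, map_val_eq_top hA (hle (Ideal.mem_span_singleton_self _))⟩

theorem isTransversal_of_surjective (hA : neg k ≤ A)
    (h : ∀ (lam : k) (m : Ideal ↥A), m.IsMaximal →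
      Ideal.map (A.val : ↥A →ₐ[k] LaurentPolynomial k[X]) m = ⊤ →
      (∃ x : ↥A, (x : LaurentPolynomial k[X]) =
        LaurentPolynomial.C X - algebraMap k (LaurentPolynomial k[X]) lam ∧ x ∈ m) →
      Function.Surjective ((Ideal.Quotient.mk (Ideal.span
        ({LaurentPolynomial.C X - algebraMap k (LaurentPolynomial k[X]) lam} :
          Set (LaurentPolynomial k[X])))).comp
        (A.val : ↥A →ₐ[k] LaurentPolynomial k[X]).toRingHom)) :
    IsTransversal A := by
  intro lam r
  let f : ↥A := ⟨LaurentPolynomial.C (X - Polynomial.C lam), hA (C_mem_neg _)⟩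
  let u : ↥A := ⟨T (-1), hA T_mem_neg⟩
  by_cases hJ : Ideal.span {u, f} = ⊤
  · obtain ⟨⟨a, ha⟩, ⟨b, hb⟩, hab⟩ := Ideal.mem_span_pair.1 ((Ideal.eq_top_iff_one _).1 hJ)
    have hab' : a * T (-1) +
        b * LaurentPolynomial.C (X - Polynomial.C lam) = 1 := congrArg Subtype.val hab
    have htop : addMul (le_top : A ≤ ⊤)
        (Algebra.mem_top (x := LaurentPolynomial.C (X - Polynomial.C lam))) = ⊤ := by
      refine eq_top_of_T_mem (hA.trans (le_addMul _ _)) ⟨a, ha, T 1 * b, trivial, ?_⟩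
      linear_combination a * T_one_mul_T_neg_one (k := k) - T 1 * hab'
    obtain ⟨a, ha, s, -, hs⟩ := htop.symm.le (Algebra.mem_top (x := r))
    exact ⟨a, ha, s, hs⟩
  · obtain ⟨m, hm, hle⟩ := Ideal.exists_le_maximal _ hJ
    obtain ⟨a, ha⟩ := h lam m hm (map_val_eq_top hA (hle (Ideal.subset_span (by simp [u]))))
      ⟨f, C_X_sub_C lam, hle (Ideal.subset_span (by simp))⟩ (Ideal.Quotient.mk _ r)
    obtain ⟨s, hs⟩ := Ideal.mem_span_singleton.1 (Ideal.Quotient.eq.1 ha.symm)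
    refine ⟨a, a.2, s, ?_⟩
    rw [C_X_sub_C, ← hs]
    simp

theorem IsTransversal.surjective (h : IsTransversal A) (lam : k) :
    Function.Surjective ((Ideal.Quotient.mk (Ideal.span
      ({LaurentPolynomial.C X - algebraMap k (LaurentPolynomial k[X]) lam} :
        Set (LaurentPolynomial k[X])))).comp
      (A.val : ↥A →ₐ[k] LaurentPolynomial k[X]).toRingHom) := by
  intro x
  obtain ⟨r, rfl⟩ := Ideal.Quotient.mk_surjective x
  obtain ⟨a, ha, s, rfl⟩ := h lam r
  refine ⟨⟨a, ha⟩, Ideal.Quotient.eq.2 (Ideal.mem_span_singleton.2 ⟨-s, ?_⟩)⟩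
  rw [← C_X_sub_C]
  change a - (a + _) = _
  ring

end Transversal

theorem isIntegral_of_mul_eq_algebraMap {A R : Type*} [CommRing A] [CommRing R] [Algebra A R]
    {x y : R} {z : A} (hz : y * x = algebraMap A R z) (p : A[X]) (hp : aeval x p = y) :
    IsIntegral A y := by
  set n := p.natDegree
  refine ⟨X ^ (n + 1) - ∑ i ∈ Finset.range (n + 1), monomial (n - i) (p.coeff i * z ^ i),
    monic_X_pow_sub ?_, ?_⟩
  · refine mem_degreeLT.1 (sum_mem fun i _ => mem_degreeLT.2 ?_)
    refine (degree_monomial_le _ _).trans_lt ?_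
    exact_mod_cast (by omega : n - i < n + 1)
  · have hy : y ^ (n + 1) = ∑ i ∈ Finset.range (n + 1), y ^ n * (p.coeff i • x ^ i) := by
      rw [← Finset.mul_sum, ← aeval_eq_sum_range, hp, pow_succ]
    rw [eval₂_sub, eval₂_X_pow, eval₂_finsetSum, hy, sub_eq_zero]
    refine Finset.sum_congr rfl fun i hi => ?_
    have hi' : n = (n - i) + i := by have := Finset.mem_range.1 hi; omega
    rw [eval₂_monomial, map_mul, map_pow, ← hz, Algebra.smul_def, mul_pow]
    conv_lhs => rw [hi', pow_add]
    ring

section Extending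

variable {R : Type*} [CommRing R] [Algebra k R] {B S : Subalgebra k R}

theorem not_isIntegral_of_map_eq_top (hBS : B ≤ S) {y : R}
    (hS : S ≤ Algebra.adjoin k (insert y (B : Set R))) {m : Ideal ↥B} (hm : m ≠ ⊤)
    (hmap : Ideal.map (Subalgebra.inclusion hBS) m = ⊤) : ¬ IsIntegral ↥B y := by
  intro hy
  have hle : S ≤ (integralClosure ↥B R).restrictScalars k := by
    refine hS.trans (Algebra.adjoin_le ?_)
    rintro z (rfl | hz)
    · exact hy
    · exact isIntegral_algebraMap (R := ↥B) (x := ⟨z, hz⟩)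
  let φ : ↥B →+* ↥S := (Subalgebra.inclusion hBS).toRingHom
  have hint : RingHom.IsIntegral (R := ↥B) (A := ↥S) φ := by
    intro x
    obtain ⟨p, hp, hpx⟩ : IsIntegral ↥B (x : R) := hle x.2
    exact ⟨p, hp, Subtype.val_injective ((hom_eval₂ p φ S.val.toRingHom x).trans hpx)⟩
  exact hm ((Ideal.map_eq_top_iff (R := ↥B) (S := ↥S) φ
    (Subalgebra.inclusion_injective hBS) hint).1 hmap)

/-- The complement of an extending maximal subalgebra is stable under multiplication by a
generator of the ambient algebra. -/
theorem mem_of_mul_mem (h : IsExtendingMaximalSubalgebraIn k B S) {x y : R} (hy : y ∈ S)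
    (hS : S ≤ Algebra.adjoin k (insert y (B : Set R))) (hx : x ∈ S) (hyx : y * x ∈ B) :
    x ∈ B := by
  obtain ⟨hBS, -, hmax, m, hm, hmap⟩ := h
  by_contra hxB
  let D : Subalgebra k R := (Algebra.adjoin ↥B {x}).restrictScalars k
  have hmem : ∀ z ∈ D, ∃ p : (↥B)[X], aeval x p = z := fun z hz =>
    (Algebra.adjoin_singleton_eq_range_aeval ↥B x).le hz
  have hBD : B < D := SetLike.lt_iff_le_and_exists.2
    ⟨fun b hb => (Algebra.adjoin ↥B {x}).algebraMap_mem ⟨b, hb⟩, x,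
      Algebra.subset_adjoin (Set.mem_singleton x), hxB⟩
  have hDS : D ≤ S := by
    intro z hz
    obtain ⟨p, rfl⟩ := hmem z hz
    rw [aeval_eq_sum_range]
    exact sum_mem fun i _ => mul_mem (hBS (p.coeff i).2) (pow_mem hx i)
  obtain ⟨p, hp⟩ := hmem y (hmax D hBD hDS ▸ hy)
  exact not_isIntegral_of_map_eq_top hBS hS hm.ne_top hmap
    (isIntegral_of_mul_eq_algebraMap (z := ⟨_, hyx⟩) rfl p hp)

end Extending

section Extension

variable {B : Subalgebra k (LaurentPolynomial k[X])}

theorem eq_pos_of_T_mem (hBp : B ≤ pos k) (hX : LaurentPolynomial.C (X : k[X]) ∈ B)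
    (hT : T 1 ∈ B) : B = pos k :=
  le_antisymm hBp <| Algebra.adjoin_le <| by
    rintro z (rfl | rfl)
    exacts [hX, hT]

theorem mem_of_T_mul_mem_of_isExtending (hX : LaurentPolynomial.C (X : k[X]) ∈ B)
    (h : IsExtendingMaximalSubalgebraIn k B (pos k)) {x : LaurentPolynomial k[X]}
    (hx : x ∈ pos k) (hTx : T 1 * x ∈ B) : x ∈ B := by
  refine mem_of_mul_mem h T_mem_pos (Algebra.adjoin_mono ?_) hx hTx
  rintro z (rfl | rfl)
  exacts [Set.mem_insert_of_mem _ hX, Set.mem_insert _ _]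

theorem C_X_sub_C_mul_mem {lam : k} {m : Ideal ↥B} (hBp : B ≤ pos k)
    (hmap : Ideal.map (Subalgebra.inclusion hBp) m = ⊤)
    (hf : ∀ s ∈ pos k, LaurentPolynomial.C (X - Polynomial.C lam) * s ∈ B)
    {s : LaurentPolynomial k[X]} (hs : s ∈ pos k) : ⟨_, hf s hs⟩ ∈ m := by
  let J : Ideal ↥(pos k) :=
    { carrier := {z | ∀ s, ∀ hs : s ∈ pos k, ⟨_, hf (s * z) (mul_mem hs z.2)⟩ ∈ m}
      zero_mem' := fun s hs => by
        convert m.zero_mem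
        simp
      add_mem' := fun {a b} ha hb s hs => by
        convert m.add_mem (ha s hs) (hb s hs)
        simp [mul_add]
      smul_mem' := fun c z hz s hs => by
        convert hz (s * c) (mul_mem hs c.2) using 2
        simp [mul_assoc] }
  have hJ : Ideal.map (Subalgebra.inclusion hBp) m ≤ J := by
    refine Ideal.map_le_iff_le_comap.2 fun b hb s hs => ?_
    convert m.mul_mem_left ⟨_, hf s hs⟩ hb using 1
    apply Subtype.ext
    simp [mul_assoc]
  have h1 : (1 : ↥(pos k)) ∈ J := hJ (by rw [hmap]; trivial)
  simpa using h1 s hs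

theorem exists_map_C_add (lam : k) (q : k[X][X]) :
    ∃ g, q = (q.map (evalRingHom lam)).map Polynomial.C +
      Polynomial.C (X - Polynomial.C lam) * g := by
  have : Polynomial.C (X - Polynomial.C lam) ∣
      q - (q.map (evalRingHom lam)).map Polynomial.C := by
    rw [C_dvd_iff_dvd_coeff]
    intro i
    rw [dvd_iff_isRoot]
    simp
  obtain ⟨g, hg⟩ := this
  exact ⟨g, by rw [← hg]; ring⟩

theorem exists_C_X_sub_C_mul_notMem (hX : LaurentPolynomial.C (X : k[X]) ∈ B)
    (h : IsExtendingMaximalSubalgebraIn k B (pos k)) (lam : k) :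
    ∃ s ∈ pos k, LaurentPolynomial.C (X - Polynomial.C lam) * s ∉ B := by
  by_contra! hf
  have hdiv := fun x => mem_of_T_mul_mem_of_isExtending (x := x) hX h
  obtain ⟨hBp, hne, -, m, hm, hmap⟩ := h
  have hfm := fun s hs => C_X_sub_C_mul_mem (s := s) hBp hmap hf hs
  let f : ↥(pos k) := ⟨LaurentPolynomial.C (X - Polynomial.C lam), C_mem_pos _⟩
  have hle : Ideal.map (Subalgebra.inclusion hBp) m ≤ Ideal.span {f} := by
    refine Ideal.map_le_iff_le_comap.2 fun b hb => ?_
    obtain ⟨b, hbB⟩ := b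
    obtain ⟨q, rfl⟩ := mem_pos_iff.1 (hBp hbB)
    obtain ⟨g, hg⟩ := exists_map_C_add lam q
    set p := q.map (evalRingHom lam) with hp
    have hgpos : toLaurent g ∈ pos k := mem_pos_iff.2 ⟨g, rfl⟩
    have hqg : toLaurent q = toLaurent (p.map Polynomial.C) +
        LaurentPolynomial.C (X - Polynomial.C lam) * toLaurent g := by
      conv_lhs => rw [hg]
      simp
    have hpB : toLaurent (p.map Polynomial.C) ∈ B := by
      have := sub_mem hbB (hf _ hgpos)
      rwa [hqg, add_sub_cancel_right] at this
    have hpm : (⟨_, hpB⟩ : ↥B) ∈ m := by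
      convert m.add_mem hb (m.mul_mem_left (-1) (hfm _ hgpos)) using 1
      apply Subtype.ext
      simp [hqg]
      ring
    have hp0 : p = 0 := by
      by_contra hp0
      have hdeg : (p.map Polynomial.C).natDegree = p.natDegree :=
        natDegree_map_eq_of_injective C_injective p
      have hlead : (p.map Polynomial.C).leadingCoeff = Polynomial.C p.leadingCoeff :=
        leadingCoeff_map_of_injective C_injective p
      have hlc : p.leadingCoeff ≠ 0 := leadingCoeff_ne_zero.2 hp0
      have hinv : algebraMap k (LaurentPolynomial k[X]) p.leadingCoeff⁻¹ *
          LaurentPolynomial.C (Polynomial.C p.leadingCoeff) = 1 := by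
        change algebraMap k (LaurentPolynomial k[X]) _ * algebraMap k _ _ = 1
        rw [← map_mul, inv_mul_cancel₀ hlc, map_one]
      by_cases hd : p.natDegree = 0
      · refine hm.ne_top ((Ideal.eq_top_iff_one m).2 ?_)
        convert m.mul_mem_left (algebraMap k ↥B p.leadingCoeff⁻¹) hpm using 1
        apply Subtype.ext
        change 1 = algebraMap k (LaurentPolynomial k[X]) _ * toLaurent _
        have hpC : p.map Polynomial.C = Polynomial.C (Polynomial.C p.leadingCoeff) := by
          rw [leadingCoeff, hd]
          conv_lhs => rw [eq_C_of_natDegree_eq_zero hd]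
          simp
        rw [hpC, toLaurent_C, hinv]
      · have := leadingCoeff_mul_T_mem (C_mem hX)
          (fun q => hdiv _ (mem_pos_iff.2 ⟨q, rfl⟩)) _ hpB (hdeg ▸ hd)
        rw [hlead] at this
        refine hne (eq_pos_of_T_mem hBp hX ?_)
        have := mul_mem (B.algebraMap_mem p.leadingCoeff⁻¹) this
        rwa [← mul_assoc, hinv, one_mul] at this
    refine Ideal.mem_span_singleton.2 ⟨⟨_, hgpos⟩, Subtype.ext ?_⟩
    change toLaurent q = LaurentPolynomial.C (X - Polynomial.C lam) * toLaurent g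
    rw [hqg, hp0]
    simp
  rw [hmap, top_le_iff, Ideal.eq_top_iff_one, Ideal.mem_span_singleton] at hle
  obtain ⟨⟨s, hs⟩, h1⟩ := hle
  obtain ⟨g, rfl⟩ := mem_pos_iff.1 hs
  have h1' : (1 : LaurentPolynomial k[X]) =
    LaurentPolynomial.C (X - Polynomial.C lam) * toLaurent g := congrArg Subtype.val h1
  rw [← toLaurent_C, ← map_mul, ← toLaurent_one, toLaurent_inj] at h1'
  have := congrArg (fun q : k[X][X] => (q.coeff 0).eval lam) h1'
  simp at this

theorem exists_eq_add_C_X_sub_C_mul (hX : LaurentPolynomial.C (X : k[X]) ∈ B)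
    (h : IsExtendingMaximalSubalgebraIn k B (pos k)) (lam : k) {r : LaurentPolynomial k[X]}
    (hr : r ∈ pos k) :
    ∃ b ∈ B, ∃ s, r = b + LaurentPolynomial.C (X - Polynomial.C lam) * s := by
  obtain ⟨s, hs, hsB⟩ := exists_C_X_sub_C_mul_notMem hX h lam
  obtain ⟨hBp, -, hmax, -⟩ := h
  have hf := C_mem_pos (X - Polynomial.C lam)
  have := hmax (addMul hBp hf) (SetLike.lt_iff_le_and_exists.2 ⟨le_addMul hBp hf, _,
    show _ ∈ addMul hBp hf from ⟨0, zero_mem _, s, hs, (zero_add _).symm⟩, hsB⟩) (by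
      rintro _ ⟨a, ha, s, hs, rfl⟩
      exact add_mem (hBp ha) (mul_mem hf hs))
  obtain ⟨b, hb, s, -, rfl⟩ := this.symm.le hr
  exact ⟨b, hb, s, rfl⟩

theorem mul_mem_add_neg (hX : LaurentPolynomial.C (X : k[X]) ∈ B) (hBp : B ≤ pos k)
    (hdiv : ∀ x ∈ pos k, T 1 * x ∈ B → x ∈ B) {s b : LaurentPolynomial k[X]}
    (hs : s ∈ neg k) (hb : b ∈ B) : ∃ c ∈ B, ∃ u ∈ neg k, s * b = c + u := by
  induction hs using Algebra.adjoin_induction generalizing b with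
  | mem x hx =>
    rcases hx with rfl | rfl
    · exact ⟨_, mul_mem hX hb, 0, zero_mem _, by simp⟩
    · obtain ⟨q, rfl⟩ := mem_pos_iff.1 (hBp hb)
      have e : toLaurent q = T 1 * toLaurent q.divX + LaurentPolynomial.C (q.coeff 0) := by
        rw [← toLaurent_X, ← toLaurent_C, ← map_mul, ← map_add, X_mul_divX_add]
      refine ⟨toLaurent q.divX, hdiv _ (mem_pos_iff.2 ⟨_, rfl⟩) ?_,
        T (-1) * LaurentPolynomial.C (q.coeff 0), mul_mem T_mem_neg (C_mem_neg _), ?_⟩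
      · have := sub_mem hb (C_mem hX (q.coeff 0))
        rwa [e, add_sub_cancel_right] at this
      · linear_combination T (-1) * e + toLaurent q.divX * T_one_mul_T_neg_one (k := k)
  | algebraMap r => exact ⟨_, mul_mem (B.algebraMap_mem r) hb, 0, zero_mem _, by simp⟩
  | add x y _ _ hx hy =>
    obtain ⟨c, hc, u, hu, h1⟩ := hx hb
    obtain ⟨d, hd, v, hv, h2⟩ := hy hb
    exact ⟨c + d, add_mem hc hd, u + v, add_mem hu hv, by linear_combination h1 + h2⟩
  | mul x y hxn _ hx hy =>
    obtain ⟨c, hc, u, hu, h1⟩ := hy hb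
    obtain ⟨d, hd, v, hv, h2⟩ := hx hc
    exact ⟨d, hd, v + x * u, add_mem hv (mul_mem hxn hu), by linear_combination x * h1 + h2⟩

/-- The subalgebra `B + k[t, y⁻¹]` of `k[t, y, y⁻¹]`. -/
noncomputable def addNeg (hX : LaurentPolynomial.C (X : k[X]) ∈ B) (hBp : B ≤ pos k)
    (hdiv : ∀ x ∈ pos k, T 1 * x ∈ B → x ∈ B) : Subalgebra k (LaurentPolynomial k[X]) where
  carrier := {x | ∃ b ∈ B, ∃ s ∈ neg k, x = b + s}
  algebraMap_mem' r := ⟨_, B.algebraMap_mem r, 0, zero_mem _, by simp⟩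
  add_mem' := by
    rintro _ _ ⟨a, ha, s, hs, rfl⟩ ⟨b, hb, u, hu, rfl⟩
    exact ⟨a + b, add_mem ha hb, s + u, add_mem hs hu, by ring⟩
  mul_mem' := by
    rintro _ _ ⟨a, ha, s, hs, rfl⟩ ⟨b, hb, u, hu, rfl⟩
    obtain ⟨c, hc, v, hv, h1⟩ := mul_mem_add_neg hX hBp hdiv hs hb
    obtain ⟨d, hd, w, hw, h2⟩ := mul_mem_add_neg hX hBp hdiv hu ha
    refine ⟨a * b + c + d, add_mem (add_mem (mul_mem ha hb) hc) hd, v + w + s * u,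
      add_mem (add_mem hv hw) (mul_mem hs hu), ?_⟩
    linear_combination h1 + h2

theorem addNeg_inf_pos (hX : LaurentPolynomial.C (X : k[X]) ∈ B) (hBp : B ≤ pos k)
    (hdiv : ∀ x ∈ pos k, T 1 * x ∈ B → x ∈ B) : addNeg hX hBp hdiv ⊓ pos k = B := by
  refine le_antisymm ?_ fun b hb => ⟨⟨b, hb, 0, zero_mem _, by simp⟩, hBp hb⟩
  rintro _ ⟨⟨b, hb, s, hs, rfl⟩, hx⟩
  obtain ⟨a, rfl⟩ := exists_eq_C (x := s) (by simpa using sub_mem hx (hBp hb)) hs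
  exact add_mem hb (C_mem hX a)

theorem exists_inf_pos_eq (hX : LaurentPolynomial.C (X : k[X]) ∈ B)
    (h : IsExtendingMaximalSubalgebraIn k B (pos k)) :
    ∃ A : Subalgebra k (LaurentPolynomial k[X]), IsExtendingMaximalSubalgebra k A ∧
      neg k ≤ A ∧ IsTransversal A ∧ A ⊓ pos k = B := by
  have hdiv := fun x => mem_of_T_mul_mem_of_isExtending (x := x) hX h
  have hW := fun lam r => exists_eq_add_C_X_sub_C_mul (r := r) hX h lam
  obtain ⟨hBp, hne, hmax, -⟩ := h
  have hinf := addNeg_inf_pos hX hBp hdiv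
  have hneg : neg k ≤ addNeg hX hBp hdiv := fun s hs => ⟨0, zero_mem _, s, hs, by simp⟩
  have hT : addNeg hX hBp hdiv ≠ ⊤ := by
    intro htop
    rw [htop, top_inf_eq] at hinf
    exact hne hinf.symm
  refine ⟨addNeg hX hBp hdiv, ⟨hT, fun D hD => ?_, exists_isMaximal_map_val_eq_top hneg hT⟩,
    hneg, fun lam r => ?_, hinf⟩
  · obtain ⟨z, hz, hzA⟩ := SetLike.exists_of_lt hD
    obtain ⟨s, hs, u, hu, rfl⟩ := exists_add z
    have hsD : s ∈ D := by simpa using sub_mem hz (hD.le (hneg hu))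
    have hlt : B < D ⊓ pos k := by
      refine SetLike.lt_iff_le_and_exists.2 ⟨hinf.symm.le.trans (inf_le_inf_right _ hD.le),
        s, Algebra.mem_inf.2 ⟨hsD, hs⟩, fun hsB => hzA ⟨s, hsB, u, hu, rfl⟩⟩
    refine eq_top_of_T_mem (hneg.trans hD.le) ?_
    exact (inf_eq_right.1 (hmax _ hlt inf_le_right)) T_mem_pos
  · obtain ⟨s, hs, u, hu, rfl⟩ := exists_add r
    obtain ⟨b, hb, v, rfl⟩ := hW lam s hs
    exact ⟨b + u, ⟨b, hb, u, hu, rfl⟩, v, by ring⟩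

end Extension

theorem le_of_inf_pos_eq {A A' : Subalgebra k (LaurentPolynomial k[X])} (hA : neg k ≤ A)
    (hA' : neg k ≤ A') (h : A ⊓ pos k = A' ⊓ pos k) : A ≤ A' := by
  intro x hx
  obtain ⟨b, hb, s, hs, rfl⟩ := exists_add_of_mem hA hx
  exact add_mem (h.le hb).1 (hA' hs)

end LaurentSubalgebra

/-- The map `Θ : 𝒩 → ℳ`, `Θ(A) = A ∩ k[t,y]`, is well-defined and bijective.
We work inside the ambient ring `k[t,y,y⁻¹] = LaurentPolynomial (Polynomial k)`,
with `t = C X`, `y = T 1`, `y⁻¹ = T (-1)`. -/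
theorem theta_bijection_N_to_M {k : Type*} [Field k] [IsAlgClosed k] :
    Set.BijOn
      (fun A : Subalgebra k (LaurentPolynomial (Polynomial k)) =>
        A ⊓ Algebra.adjoin k
          {LaurentPolynomial.C (Polynomial.X : Polynomial k), LaurentPolynomial.T 1})
      -- 𝒩: extending maximal k-subalgebras A of k[t,y,y⁻¹] containing k[t,y⁻¹] such
      -- that for every λ and every maximal ideal 𝔪 of A with unit extension and
      -- t - λ ∈ 𝔪, the composite A → k[t,y,y⁻¹] → k[t,y,y⁻¹]/(t - λ) is surjective
      {A | IsExtendingMaximalSubalgebra k A ∧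
        Algebra.adjoin k
          {LaurentPolynomial.C (Polynomial.X : Polynomial k), LaurentPolynomial.T (-1)} ≤ A ∧
        ∀ (lam : k) (m : Ideal ↥A), m.IsMaximal →
          Ideal.map (A.val : ↥A →ₐ[k] LaurentPolynomial (Polynomial k)) m = ⊤ →
          (∃ x : ↥A, (x : LaurentPolynomial (Polynomial k)) =
              LaurentPolynomial.C (Polynomial.X : Polynomial k) -
                algebraMap k (LaurentPolynomial (Polynomial k)) lam ∧ x ∈ m) →
          Function.Surjective
            ((Ideal.Quotient.mk (Ideal.span
                ({LaurentPolynomial.C (Polynomial.X : Polynomial k) -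
                  algebraMap k (LaurentPolynomial (Polynomial k)) lam} :
                  Set (LaurentPolynomial (Polynomial k))))).comp
              (A.val : ↥A →ₐ[k] LaurentPolynomial (Polynomial k)).toRingHom)}
      -- ℳ: extending maximal k-subalgebras of k[t,y] containing k[t]
      {B | IsExtendingMaximalSubalgebraIn k B
          (Algebra.adjoin k
            {LaurentPolynomial.C (Polynomial.X : Polynomial k), LaurentPolynomial.T 1}) ∧
        Algebra.adjoin k {LaurentPolynomial.C (Polynomial.X : Polynomial k)} ≤ B} := by
  open LaurentSubalgebra in
  refine ⟨?_, ?_, ?_⟩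
  · rintro A ⟨⟨hne, hmax, -⟩, hA, hsurj⟩
    refine ⟨isExtendingMaximalSubalgebraIn_inf hA (isTransversal_of_surjective hA hsurj) hne hmax,
      Algebra.adjoin_le ?_⟩
    rintro _ rfl
    exact ⟨hA (C_mem_neg _), C_mem_pos _⟩
  · rintro A ⟨-, hA, -⟩ A' ⟨-, hA', -⟩ h
    exact le_antisymm (le_of_inf_pos_eq hA hA' h) (le_of_inf_pos_eq hA' hA h.symm)
  · rintro B ⟨hB, hX⟩
    obtain ⟨A, hAext, hA, hW, hAB⟩ := exists_inf_pos_eq (hX (Algebra.subset_adjoin rfl)) hB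
    exact ⟨A, ⟨hAext, hA, fun lam _ _ _ _ => hW.surjective lam⟩, hAB⟩
end
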